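/- arXiv:1804.08190 — 6 statements merged into one kernel-verified Lean document; each statement's English description precedes it below -/
import Mathlib

section
/- Let A : ℝ³ → ℝ³ be a linear isometry and let f₁, …, f₆ be Schwartz functions on ℝ. Then E_A(𝓕f₁, 𝓕f₂, 𝓕f₃, 𝓕f₄, 𝓕f₅, 𝓕f₆) = E_A(f₁, f₂, f₃, f₄, f₅, f₆); that is, E_A is invariant under replacing every argument by its Fourier transform. -/
open MeasureTheory Matrix SchwartzMap
open scoped ENNReal ComplexConjugate FourierTransform

/-- The multilinear functional `E_A` associated to a linear map `A : ℝ³ → ℝ³`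
(given as a matrix). -/
noncomputable def EA (A : Matrix (Fin 3) (Fin 3) ℝ) (f₁ f₂ f₃ f₄ f₅ f₆ : ℝ → ℂ) : ℂ :=
  ∫ x : Fin 3 → ℝ,
    f₁ (A.mulVec x 0) * f₂ (A.mulVec x 1) * f₃ (A.mulVec x 2) *
      conj (f₄ (x 0) * f₅ (x 1) * f₆ (x 2))

theorem SchwartzMap.fourier_conj_fourier (f : 𝓢(ℝ, ℂ)) (x : ℝ) :
    𝓕 (fun y ↦ conj (𝓕 (f : ℝ → ℂ) y)) x = conj (f x) := by
  have h : 𝓕⁻ (𝓕 (f : ℝ → ℂ)) = f := by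
    rw [← fourier_coe, ← fourierInv_coe, FourierTransform.fourierInv_fourier_eq]
  conv_rhs => rw [← h]
  rw [Real.fourier_real_eq, Real.fourierInv_eq', ← integral_conj]
  refine integral_congr_ae (.of_forall fun v ↦ ?_)
  simp only [Circle.smul_def, Real.fourierChar_apply, smul_eq_mul, map_mul, ← Complex.exp_conj,
    Complex.conj_I, Complex.conj_ofReal]
  congr 2
  simp [mul_comm]

section OrthogonalInvariance

variable {ι : Type*} [Fintype ι]

/-- The Fourier integral of a function on `ι → ℝ`, with respect to the dot product. -/
noncomputable abbrev piFourierIntegral (F : (ι → ℝ) → ℂ) : (ι → ℝ) → ℂ :=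
  VectorFourier.fourierIntegral Real.fourierChar volume (dotProductBilin ℝ ℝ) F

theorem piFourierIntegral_prod (f : ι → ℝ → ℂ) (w : ι → ℝ) :
    piFourierIntegral (fun v ↦ ∏ i, f i (v i)) w = ∏ i, 𝓕 (f i) (w i) := by
  simp only [Real.fourier_real_eq]
  rw [← integral_fintype_prod_volume_eq_prod]
  refine integral_congr_ae (.of_forall fun v ↦ ?_)
  simp only [Circle.smul_def, smul_eq_mul, Finset.prod_mul_distrib, Real.fourierChar_apply,
    ← Complex.exp_sum, dotProductBilin_apply_apply, dotProduct]
  congr 2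
  push_cast
  simp only [← Finset.sum_mul, ← Finset.mul_sum, Finset.sum_neg_distrib]

theorem measurePreserving_mulVec_of_transpose_mul_self [DecidableEq ι] {A : Matrix ι ι ℝ}
    (hA : Aᵀ * A = 1) : MeasurePreserving (A *ᵥ ·) := by
  have hdet : |A.det| = 1 := by
    have h := congrArg det hA
    rw [det_mul, det_transpose, det_one] at h
    rcases mul_self_eq_one_iff.mp h with h | h <;> simp [h]
  have hne : A.det ≠ 0 := fun h ↦ by simp [h] at hdet
  refine ⟨(Continuous.matrix_mulVec continuous_const continuous_id).measurable, ?_⟩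
  have h := Real.map_matrix_volume_pi_eq_smul_volume_pi hne
  rw [abs_inv, hdet, inv_one, ENNReal.ofReal_one, one_smul] at h
  exact h

theorem measurableEmbedding_mulVec_of_transpose_mul_self [DecidableEq ι] {A : Matrix ι ι ℝ}
    (hA : Aᵀ * A = 1) : MeasurableEmbedding (A *ᵥ ·) := by
  refine Continuous.measurableEmbedding
    (Continuous.matrix_mulVec continuous_const continuous_id) fun x y h ↦ ?_
  simpa [hA] using congrArg (Aᵀ *ᵥ ·) h

theorem piFourierIntegral_comp_mulVec [DecidableEq ι] {A : Matrix ι ι ℝ} (hA : Aᵀ * A = 1)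
    (F : (ι → ℝ) → ℂ) (w : ι → ℝ) :
    piFourierIntegral (fun v ↦ F (A *ᵥ v)) w = piFourierIntegral F (A *ᵥ w) := by
  unfold piFourierIntegral VectorFourier.fourierIntegral
  rw [← (measurePreserving_mulVec_of_transpose_mul_self hA).integral_comp
    (measurableEmbedding_mulVec_of_transpose_mul_self hA)
    fun v ↦ Real.fourierChar (-dotProductBilin ℝ ℝ v (A *ᵥ w)) • F v]
  refine integral_congr_ae (.of_forall fun v ↦ ?_)
  have h : A *ᵥ v ⬝ᵥ A *ᵥ w = v ⬝ᵥ w := by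
    rw [dotProduct_mulVec, ← mulVec_transpose, mulVec_mulVec, hA, one_mulVec]
  simp [h]

theorem integral_prod_fourier_mulVec [DecidableEq ι] {A : Matrix ι ι ℝ}
    (hA : Aᵀ * A = 1) (f g : ι → 𝓢(ℝ, ℂ)) :
    ∫ x : ι → ℝ, (∏ i, 𝓕 (f i : ℝ → ℂ) ((A *ᵥ x) i)) * ∏ i, conj (𝓕 (g i : ℝ → ℂ) (x i)) =
      ∫ x : ι → ℝ, (∏ i, f i ((A *ᵥ x) i)) * ∏ i, conj (g i (x i)) := by
  have hf : Integrable fun v : ι → ℝ ↦ ∏ i, f i ((A *ᵥ v) i) :=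
    (measurePreserving_mulVec_of_transpose_mul_self hA).integrable_comp_of_integrable
      (Integrable.fintype_prod fun i ↦ (f i).integrable)
  have hg : Integrable fun v : ι → ℝ ↦ ∏ i, conj (𝓕 (g i : ℝ → ℂ) (v i)) :=
    Integrable.fintype_prod (f := fun i y ↦ conj (𝓕 (g i : ℝ → ℂ) y)) fun i ↦
      (Complex.conjLIE.integrable_comp_iff).2 (𝓕 (g i)).integrable
  have hL : Continuous fun p : (ι → ℝ) × (ι → ℝ) ↦ dotProductBilin ℝ ℝ p.1 p.2 := by
    simp only [dotProductBilin_apply_apply]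
    fun_prop
  have hflip : (dotProductBilin ℝ ℝ : (ι → ℝ) →ₗ[ℝ] (ι → ℝ) →ₗ[ℝ] ℝ).flip = dotProductBilin ℝ ℝ := by
    ext
    simp [dotProduct_comm]
  have key := VectorFourier.integral_fourierIntegral_smul_eq_flip Real.continuous_fourierChar
    hL hf hg
  simpa only [hflip, smul_eq_mul, piFourierIntegral_prod (fun i y ↦ conj (𝓕 (g i : ℝ → ℂ) y)),
    piFourierIntegral_comp_mulVec hA (fun v ↦ ∏ i, f i (v i)),
    piFourierIntegral_prod (fun i ↦ (f i : ℝ → ℂ)), fourier_conj_fourier] using key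

end OrthogonalInvariance

theorem stmt1 (A : Matrix (Fin 3) (Fin 3) ℝ) (hA : Aᵀ * A = 1)
    (f₁ f₂ f₃ f₄ f₅ f₆ : SchwartzMap ℝ ℂ) :
    EA A (𝓕 (f₁ : ℝ → ℂ)) (𝓕 (f₂ : ℝ → ℂ)) (𝓕 (f₃ : ℝ → ℂ))
        (𝓕 (f₄ : ℝ → ℂ)) (𝓕 (f₅ : ℝ → ℂ)) (𝓕 (f₆ : ℝ → ℂ))
      = EA A f₁ f₂ f₃ f₄ f₅ f₆ := by
  simpa [EA, Fin.prod_univ_three] using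
    integral_prod_fourier_mulVec hA ![f₁, f₂, f₃] ![f₄, f₅, f₆]
end

section
/- For λ ∈ ℝ define the 3×3 real matrices B(λ) with rows (1,0,1), (λ,1,0), (0,λ,1−λ), and C(λ) with rows (λ,0,1), (1,λ,1−λ), (0,1,0). Then for every λ ∈ ℝ: (i) det C(λ) = λ² − λ + 1 > 0, so C(λ) is invertible; (ii) the matrix A(λ) := B(λ) C(λ)⁻¹ equals (λ² − λ + 1)⁻¹ times the matrix with rows (λ, 1−λ, λ²−λ), (λ²−λ, λ, 1−λ), (1−λ, λ²−λ, λ); (iii) A(λ) is orthogonal, i.e. A(λ)ᵀ A(λ) = I; and (iv) A(λ) fixes the vector (1,1,1), i.e. A(λ)·(1,1,1) = (1,1,1). -/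
open Matrix

/-- The matrix `B(λ)`. -/
noncomputable def Bmat (l : ℝ) : Matrix (Fin 3) (Fin 3) ℝ :=
  !![1, 0, 1; l, 1, 0; 0, l, 1 - l]

/-- The matrix `C(λ)`. -/
noncomputable def Cmat (l : ℝ) : Matrix (Fin 3) (Fin 3) ℝ :=
  !![l, 0, 1; 1, l, 1 - l; 0, 1, 0]

theorem det_Cmat (l : ℝ) : (Cmat l).det = l ^ 2 - l + 1 := by
  simp [Cmat, det_fin_three]
  ring

theorem sq_sub_self_add_one_pos (l : ℝ) : 0 < l ^ 2 - l + 1 := by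
  nlinarith [sq_nonneg (l - 1 / 2)]

theorem isUnit_det_Cmat (l : ℝ) : IsUnit (Cmat l).det := by
  rw [det_Cmat]
  exact (sq_sub_self_add_one_pos l).ne'.isUnit

theorem Bmat_mul_inv_Cmat (l : ℝ) :
    Bmat l * (Cmat l)⁻¹ =
      (l ^ 2 - l + 1)⁻¹ •
        !![l, 1 - l, l ^ 2 - l; l ^ 2 - l, l, 1 - l; 1 - l, l ^ 2 - l, l] := by
  have hd := (sq_sub_self_add_one_pos l).ne'
  have h : Bmat l = ((l ^ 2 - l + 1)⁻¹ •
      !![l, 1 - l, l ^ 2 - l; l ^ 2 - l, l, 1 - l; 1 - l, l ^ 2 - l, l]) * Cmat l := by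
    rw [smul_mul, eq_inv_smul_iff₀ hd]
    ext i j
    fin_cases i <;> fin_cases j <;>
      simp [Bmat, Cmat, Matrix.mul_apply, Fin.sum_univ_three] <;> ring
  rw [h, mul_nonsing_inv_cancel_right _ _ (isUnit_det_Cmat l)]

theorem stmt3 (l : ℝ) :
    ((Cmat l).det = l ^ 2 - l + 1 ∧ 0 < (Cmat l).det ∧ IsUnit (Cmat l).det) ∧
    Bmat l * (Cmat l)⁻¹ =
      (l ^ 2 - l + 1)⁻¹ •
        !![l, 1 - l, l ^ 2 - l; l ^ 2 - l, l, 1 - l; 1 - l, l ^ 2 - l, l] ∧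
    (Bmat l * (Cmat l)⁻¹)ᵀ * (Bmat l * (Cmat l)⁻¹) = 1 ∧
    (Bmat l * (Cmat l)⁻¹).mulVec (fun _ => 1) = fun _ => 1 := by
  have hd := (sq_sub_self_add_one_pos l).ne'
  refine ⟨⟨det_Cmat l, ?_, isUnit_det_Cmat l⟩, Bmat_mul_inv_Cmat l, ?_, ?_⟩
  · rw [det_Cmat]
    exact sq_sub_self_add_one_pos l
  · rw [Bmat_mul_inv_Cmat, transpose_smul, smul_mul, Matrix.mul_smul, inv_smul_eq_iff₀ hd,
      inv_smul_eq_iff₀ hd]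
    ext i j
    fin_cases i <;> fin_cases j <;>
      simp [Matrix.mul_apply, Fin.sum_univ_three] <;> ring
  · rw [Bmat_mul_inv_Cmat, smul_mulVec, inv_smul_eq_iff₀ hd]
    ext i
    fin_cases i <;> simp [mulVec, dotProduct, Fin.sum_univ_three] <;> ring
end

section
/- Let α, β, γ ∈ ℂ with Re α > 0, and let f(x) = γ e^{−αx² + βx}. Then the inequality |𝓔₆(f,f,f,f,f,f)| ≤ (1/(π√3)) ‖f‖_{L²}⁶ holds with equality: |𝓔₆(f,f,f,f,f,f)| = (1/(π√3)) ‖f‖_{L²}⁶. -/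
open MeasureTheory
open scoped ENNReal ComplexConjugate Real

/-- The sextilinear functional `𝓔₆`, with integration variables `(β, γ, ξ, λ)`. -/
noncomputable def E6 (f₁ f₂ f₃ f₄ f₅ f₆ : ℝ → ℂ) : ℂ :=
  ((1 / (2 * π ^ 2) : ℝ) : ℂ) *
    ∫ p : ℝ × ℝ × ℝ × ℝ,
      f₁ (p.1 + p.2.2.1) * f₂ (p.2.2.2 * p.1 + p.2.1) *
        f₃ (p.2.2.2 * p.2.1 + p.2.2.1 - p.2.2.2 * p.2.2.1) *
        conj (f₄ (p.2.2.2 * p.1 + p.2.2.1) *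
          f₅ (p.1 + p.2.2.2 * p.2.1 + p.2.2.1 - p.2.2.2 * p.2.2.1) * f₆ (p.2.1))

theorem lintegral_comp_const_sub_mul (g : ℝ → ℝ≥0∞) (c : ℝ) {d : ℝ} (hd : 0 < d) :
    ∫⁻ x, g (c - x * d) = ENNReal.ofReal d⁻¹ * ∫⁻ x, g x := by
  have h : ∫⁻ x, g (c - x) = ∫⁻ x, g x := lintegral_sub_left_eq_self g c
  have hm : Measure.map (fun x : ℝ => x * d) volume = ENNReal.ofReal |d⁻¹| • volume :=
    Real.map_volume_mul_right hd.ne'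
  have he : MeasurableEmbedding (fun x : ℝ => x * d) := measurableEmbedding_mulRight₀ hd.ne'
  rw [← he.lintegral_map (fun y => g (c - y)), hm, lintegral_smul_measure, h,
    abs_of_pos (inv_pos.2 hd), smul_eq_mul]

theorem lintegral_inv_sq_sub_add_one :
    ∫⁻ x : ℝ, ENNReal.ofReal (x ^ 2 - x + 1)⁻¹ = ENNReal.ofReal (2 * π / √3) := by
  have h3 : (0 : ℝ) < √3 := by positivity
  have hsq : √3 ^ 2 = (3 : ℝ) := Real.sq_sqrt (by norm_num)
  have hcomp : ∀ x : ℝ, (x ^ 2 - x + 1)⁻¹ =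
      4 / 3 * (1 + ((x - 1 / 2) * (2 / √3)) ^ 2)⁻¹ := by
    intro x
    have hx : x ^ 2 - x + 1 = 3 / 4 * (1 + ((x - 1 / 2) * (2 / √3)) ^ 2) := by
      rw [mul_pow, div_pow, hsq]; ring
    rw [hx, mul_inv]; norm_num
  have hintegrable : Integrable (fun x : ℝ => 4 / 3 * (1 + ((x - 1 / 2) * (2 / √3)) ^ 2)⁻¹) :=
    ((integrable_inv_one_add_sq.comp_mul_right' (by positivity)).comp_sub_right (1 / 2)).const_mul _
  simp_rw [hcomp]
  rw [← ofReal_integral_eq_lintegral_ofReal hintegrable (.of_forall fun x => by positivity)]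
  congr 1
  rw [integral_const_mul,
    integral_sub_right_eq_self (fun x : ℝ => (1 + (x * (2 / √3)) ^ 2)⁻¹) (1 / 2),
    Measure.integral_comp_mul_right (fun x : ℝ => (1 + x ^ 2)⁻¹), integral_univ_inv_one_add_sq,
    abs_of_pos (by positivity), smul_eq_mul]
  field_simp
  rw [hsq]; ring

theorem lintegral_triple_product (g : ℝ → ℝ≥0∞) (hg : Measurable g) (l : ℝ) :
    ∫⁻ b, ∫⁻ c, ∫⁻ x, g (b + x) * g (l * b + c) * g (l * c + x - l * x) =
      ENNReal.ofReal (l ^ 2 - l + 1)⁻¹ * (∫⁻ x, g x) ^ 3 := by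
  have hd : 0 < l ^ 2 - l + 1 := by nlinarith [sq_nonneg (l - 1 / 2)]
  have hshift : ∀ b : ℝ, ∫⁻ c, ∫⁻ x, g (b + x) * g (l * b + c) * g (l * c + x - l * x) =
      ∫⁻ c, ∫⁻ x, g x * g c * g (l * c + (1 - l) * x - b * (l ^ 2 - l + 1)) := by
    intro b
    rw [← lintegral_add_left_eq_self
      (fun c => ∫⁻ x, g x * g c * g (l * c + (1 - l) * x - b * (l ^ 2 - l + 1))) (l * b)]
    refine lintegral_congr fun c => ?_
    rw [← lintegral_add_left_eq_self (fun x => g x * g (l * b + c) *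
      g (l * (l * b + c) + (1 - l) * x - b * (l ^ 2 - l + 1))) b]
    refine lintegral_congr fun x => ?_
    congr 2
    ring
  simp_rw [hshift]
  have hprod : ∀ b : ℝ, ∫⁻ c, ∫⁻ x, g x * g c * g (l * c + (1 - l) * x - b * (l ^ 2 - l + 1)) =
      ∫⁻ q : ℝ × ℝ, g q.2 * g q.1 * g (l * q.1 + (1 - l) * q.2 - b * (l ^ 2 - l + 1)) := by
    intro b
    rw [Measure.volume_eq_prod, lintegral_prod _ (by fun_prop)]
  simp_rw [hprod]
  rw [lintegral_lintegral_swap (by unfold Function.uncurry; fun_prop)]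
  have hinner : ∀ q : ℝ × ℝ,
      ∫⁻ b, g q.2 * g q.1 * g (l * q.1 + (1 - l) * q.2 - b * (l ^ 2 - l + 1)) =
        g q.1 * g q.2 * (ENNReal.ofReal (l ^ 2 - l + 1)⁻¹ * ∫⁻ x, g x) := by
    intro q
    rw [lintegral_const_mul _ (by fun_prop), lintegral_comp_const_sub_mul g _ hd, mul_comm (g q.2)]
  simp_rw [hinner]
  rw [lintegral_mul_const _ (by fun_prop), Measure.volume_eq_prod,
    lintegral_prod_mul hg.aemeasurable hg.aemeasurable]
  ring

theorem lintegral_quadruple_product (g : ℝ → ℝ≥0∞) (hg : Measurable g) :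
    ∫⁻ p : ℝ × ℝ × ℝ × ℝ, g (p.1 + p.2.2.1) * g (p.2.2.2 * p.1 + p.2.1) *
        g (p.2.2.2 * p.2.1 + p.2.2.1 - p.2.2.2 * p.2.2.1) =
      ENNReal.ofReal (2 * π / √3) * (∫⁻ x, g x) ^ 3 := by
  calc
    _ = ∫⁻ b : ℝ, ∫⁻ c : ℝ, ∫⁻ x : ℝ, ∫⁻ l : ℝ,
        g (b + x) * g (l * b + c) * g (l * c + x - l * x) := by
      rw [Measure.volume_eq_prod, lintegral_prod _ (by fun_prop)]
      refine lintegral_congr fun b => ?_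
      rw [Measure.volume_eq_prod, lintegral_prod _ (by fun_prop)]
      refine lintegral_congr fun c => ?_
      rw [Measure.volume_eq_prod, lintegral_prod _ (by fun_prop)]
    _ = ∫⁻ b : ℝ, ∫⁻ c : ℝ, ∫⁻ l : ℝ, ∫⁻ x : ℝ,
        g (b + x) * g (l * b + c) * g (l * c + x - l * x) := by
      refine lintegral_congr fun b => lintegral_congr fun c => ?_
      exact lintegral_lintegral_swap (by unfold Function.uncurry; fun_prop)
    _ = ∫⁻ b : ℝ, ∫⁻ l : ℝ, ∫⁻ c : ℝ, ∫⁻ x : ℝ,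
        g (b + x) * g (l * b + c) * g (l * c + x - l * x) := by
      refine lintegral_congr fun b => ?_
      refine lintegral_lintegral_swap (Measurable.aemeasurable ?_)
      unfold Function.uncurry
      exact Measurable.lintegral_prod_right (by fun_prop)
    _ = ∫⁻ l : ℝ, ∫⁻ b : ℝ, ∫⁻ c : ℝ, ∫⁻ x : ℝ,
        g (b + x) * g (l * b + c) * g (l * c + x - l * x) := by
      refine lintegral_lintegral_swap (Measurable.aemeasurable ?_)
      unfold Function.uncurry
      refine Measurable.lintegral_prod_right ?_
      exact Measurable.lintegral_prod_right (by fun_prop)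
    _ = _ := by
      simp_rw [lintegral_triple_product g hg]
      rw [lintegral_mul_const _ (by fun_prop), lintegral_inv_sq_sub_add_one]

/-- Gaussians depend on a triple, in modulus and phase, only through its sum and sum of squares. -/
theorem gaussian_product_mul_conj (α β γ : ℂ) {a₁ a₂ a₃ b₁ b₂ b₃ : ℝ}
    (h₁ : b₁ + b₂ + b₃ = a₁ + a₂ + a₃)
    (h₂ : b₁ ^ 2 + b₂ ^ 2 + b₃ ^ 2 = a₁ ^ 2 + a₂ ^ 2 + a₃ ^ 2)
    (f : ℝ → ℂ) (hf : f = fun x : ℝ => γ * Complex.exp (-α * (x : ℂ) ^ 2 + β * (x : ℂ))) :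
    f a₁ * f a₂ * f a₃ * conj (f b₁ * f b₂ * f b₃) =
      ((‖f a₁‖ ^ 2 * ‖f a₂‖ ^ 2 * ‖f a₃‖ ^ 2 : ℝ) : ℂ) := by
  have hprod : ∀ x y z : ℝ, f x * f y * f z = γ ^ 3 *
      Complex.exp (-α * ((x ^ 2 + y ^ 2 + z ^ 2 : ℝ) : ℂ) + β * ((x + y + z : ℝ) : ℂ)) := by
    intro x y z
    have he : -α * ((x ^ 2 + y ^ 2 + z ^ 2 : ℝ) : ℂ) + β * ((x + y + z : ℝ) : ℂ) =
        (-α * (x : ℂ) ^ 2 + β * x) + (-α * (y : ℂ) ^ 2 + β * y) + (-α * (z : ℂ) ^ 2 + β * z) := by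
      push_cast; ring
    rw [he, Complex.exp_add, Complex.exp_add, hf]
    ring
  have hb : f b₁ * f b₂ * f b₃ = f a₁ * f a₂ * f a₃ := by rw [hprod, hprod, h₁, h₂]
  rw [hb, Complex.mul_conj, Complex.normSq_eq_norm_sq, norm_mul, norm_mul, mul_pow, mul_pow]

theorem stmt6 (α β γ : ℂ) (hα : 0 < α.re)
    (f : ℝ → ℂ) (hf : f = fun x : ℝ => γ * Complex.exp (-α * (x : ℂ) ^ 2 + β * (x : ℂ))) :
    ‖E6 f f f f f f‖ =
      (1 / (π * Real.sqrt 3)) * (eLpNorm f 2 volume).toReal ^ 6 := by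
  have hmeas : Measurable f := by
    rw [hf]
    fun_prop
  have hpoint : ∀ p : ℝ × ℝ × ℝ × ℝ,
      f (p.1 + p.2.2.1) * f (p.2.2.2 * p.1 + p.2.1) *
        f (p.2.2.2 * p.2.1 + p.2.2.1 - p.2.2.2 * p.2.2.1) *
        conj (f (p.2.2.2 * p.1 + p.2.2.1) *
          f (p.1 + p.2.2.2 * p.2.1 + p.2.2.1 - p.2.2.2 * p.2.2.1) * f (p.2.1)) =
      ((‖f (p.1 + p.2.2.1)‖ ^ 2 * ‖f (p.2.2.2 * p.1 + p.2.1)‖ ^ 2 *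
        ‖f (p.2.2.2 * p.2.1 + p.2.2.1 - p.2.2.2 * p.2.2.1)‖ ^ 2 : ℝ) : ℂ) := fun p =>
    gaussian_product_mul_conj α β γ (by ring) (by ring) f hf
  have hnorm : eLpNorm f 2 volume ^ 2 = ∫⁻ x, ‖f x‖ₑ ^ 2 := by
    simpa using eLpNorm_nnreal_pow_eq_lintegral (μ := volume) (f := f) (p := 2) two_ne_zero
  unfold E6
  simp_rw [hpoint]
  rw [integral_complex_ofReal, integral_eq_lintegral_of_nonneg_ae
    (.of_forall fun p => by positivity) (by fun_prop)]
  have hg : ∀ p : ℝ × ℝ × ℝ × ℝ, ENNReal.ofReal (‖f (p.1 + p.2.2.1)‖ ^ 2 *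
      ‖f (p.2.2.2 * p.1 + p.2.1)‖ ^ 2 *
        ‖f (p.2.2.2 * p.2.1 + p.2.2.1 - p.2.2.2 * p.2.2.1)‖ ^ 2) =
      ‖f (p.1 + p.2.2.1)‖ₑ ^ 2 * ‖f (p.2.2.2 * p.1 + p.2.1)‖ₑ ^ 2 *
        ‖f (p.2.2.2 * p.2.1 + p.2.2.1 - p.2.2.2 * p.2.2.1)‖ₑ ^ 2 := by
    intro p
    rw [ENNReal.ofReal_mul (by positivity), ENNReal.ofReal_mul (by positivity)]
    simp only [ENNReal.ofReal_pow (norm_nonneg _), ofReal_norm]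
  simp_rw [hg]
  rw [lintegral_quadruple_product (fun x => ‖f x‖ₑ ^ 2) (by fun_prop), ← hnorm, ← pow_mul,
    ← Complex.ofReal_mul, Complex.norm_real, ENNReal.toReal_mul, ENNReal.toReal_pow,
    ENNReal.toReal_ofReal (by positivity), Real.norm_of_nonneg (by positivity)]
  have := Real.pi_pos
  field_simp
end

section
/- For every s > 1/2 there exists a constant C > 0 such that for all measurable f₁, …, f₅ : ℝ → ℂ with M_k := sup_{t ∈ ℝ} ⟨t⟩^s |f_k(t)| < ∞ for each k, the integral defining 𝓣₆(f₁,…,f₅)(x) converges absolutely for every x, and ⟨x⟩^s |𝓣₆(f₁,…,f₅)(x)| ≤ C ∏_{k=1}^{5} M_k for every x ∈ ℝ. -/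
open MeasureTheory
open scoped ENNReal ComplexConjugate Real

/-- The quintilinear operator `𝓣₆`, with integration variables `(β, ξ, λ)`. -/
noncomputable def T6 (f₁ f₂ f₃ f₄ f₅ : ℝ → ℂ) (x : ℝ) : ℂ :=
  ((3 / π ^ 2 : ℝ) : ℂ) *
    ∫ p : ℝ × ℝ × ℝ,
      f₁ (p.1 + p.2.1) * f₂ (p.2.2 * p.1 + x) *
        f₃ (p.2.2 * x + p.2.1 - p.2.2 * p.2.1) *
        conj (f₄ (p.2.2 * p.1 + p.2.1) *
          f₅ (p.1 + p.2.2 * x + p.2.1 - p.2.2 * p.2.1))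

/-- The Japanese bracket `⟨t⟩ = √(1+t²)`. -/
noncomputable def jap (t : ℝ) : ℝ := Real.sqrt (1 + t ^ 2)

theorem lintegral_affine_mul_affine {g : ℝ → ℝ≥0∞} (hg : Measurable g) {a b c d : ℝ} (e f : ℝ)
    (hdet : a * d - b * c ≠ 0) :
    ∫⁻ p : ℝ × ℝ, g (a * p.1 + b * p.2 + e) * g (c * p.1 + d * p.2 + f) =
      ENNReal.ofReal |a * d - b * c|⁻¹ * (∫⁻ t, g t) ^ 2 := by
  set φ := Matrix.toLin (Module.Basis.finTwoProd ℝ) (Module.Basis.finTwoProd ℝ) !![a, b; c, d]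
  have hφ : LinearMap.det φ = a * d - b * c := by
    rw [LinearMap.det_toLin, Matrix.det_fin_two_of]
  have hmap := Measure.map_linearMap_addHaar_eq_smul_addHaar (volume : Measure (ℝ × ℝ))
    (f := φ) (by rwa [hφ])
  have hφm : Measurable φ := φ.continuous_of_finiteDimensional.measurable
  have hG : Measurable fun q : ℝ × ℝ => g (q.1 + e) * g (q.2 + f) := by fun_prop
  calc ∫⁻ p : ℝ × ℝ, g (a * p.1 + b * p.2 + e) * g (c * p.1 + d * p.2 + f)
      = ∫⁻ q, g (q.1 + e) * g (q.2 + f) ∂(Measure.map φ volume) := by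
        rw [lintegral_map hG hφm]
        simp only [φ, Matrix.toLin_finTwoProd_apply]
    _ = ENNReal.ofReal |a * d - b * c|⁻¹ * (∫⁻ t, g t) ^ 2 := by
        rw [hmap, lintegral_smul_measure, Measure.volume_eq_prod,
          lintegral_prod_mul (f := fun t => g (t + e)) (g := fun t => g (t + f))
            (by fun_prop) (by fun_prop),
          lintegral_add_right_eq_self g e, lintegral_add_right_eq_self g f, hφ, abs_inv, sq,
          smul_eq_mul]

theorem lintegral_four_affine_le {w : ℝ → ℝ≥0∞} (hw : Measurable w)
    {a₁ b₁ a₂ b₂ a₃ b₃ a₄ b₄ : ℝ} (e₁ e₂ e₃ e₄ : ℝ)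
    (h₁₂ : a₁ * b₂ - b₁ * a₂ ≠ 0) (h₃₄ : a₃ * b₄ - b₃ * a₄ ≠ 0) :
    ∫⁻ p : ℝ × ℝ, w (a₁ * p.1 + b₁ * p.2 + e₁) * w (a₂ * p.1 + b₂ * p.2 + e₂) *
        (w (a₃ * p.1 + b₃ * p.2 + e₃) * w (a₄ * p.1 + b₄ * p.2 + e₄)) ≤
      (∫⁻ t, w t ^ (2 : ℝ)) ^ 2 * ENNReal.ofReal
        (|(a₁ * b₂ - b₁ * a₂) * (a₃ * b₄ - b₃ * a₄)| ^ (-(1 / 2) : ℝ)) := by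
  set A := ∫⁻ t, w t ^ (2 : ℝ)
  have hw2 : Measurable fun t => w t ^ (2 : ℝ) := by fun_prop
  refine (ENNReal.lintegral_mul_le_Lp_mul_Lq volume Real.HolderConjugate.two_two
    (f := fun p : ℝ × ℝ => w (a₁ * p.1 + b₁ * p.2 + e₁) * w (a₂ * p.1 + b₂ * p.2 + e₂))
    (g := fun p : ℝ × ℝ => w (a₃ * p.1 + b₃ * p.2 + e₃) * w (a₄ * p.1 + b₄ * p.2 + e₄))
    (by fun_prop) (by fun_prop)).trans_eq ?_
  simp only [ENNReal.mul_rpow_of_nonneg _ _ zero_le_two]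
  rw [lintegral_affine_mul_affine hw2 e₁ e₂ h₁₂, lintegral_affine_mul_affine hw2 e₃ e₄ h₃₄,
    ← ENNReal.mul_rpow_of_nonneg _ _ (by norm_num)]
  rw [abs_mul, Real.rpow_neg (by positivity), ← Real.inv_rpow (by positivity), mul_inv,
    ← ENNReal.ofReal_rpow_of_nonneg (by positivity) (by norm_num),
    ENNReal.ofReal_mul (by positivity)]
  rw [show ∀ u v : ℝ≥0∞, u * A ^ 2 * (v * A ^ 2) = (u * v) * (A ^ 2) ^ (2 : ℝ) by
      intro u v; rw [ENNReal.rpow_two]; ring,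
    ENNReal.mul_rpow_of_nonneg _ _ (by norm_num), ← ENNReal.rpow_mul]
  norm_num [mul_comm]

/-- An integrable majorant for the inverse square roots of the Jacobians in `𝓣₆`. -/
noncomputable def jacobianMajorant (t : ℝ) : ℝ := (|t| * (1 + t ^ 2)) ^ (-(1 / 2) : ℝ)

theorem jacobianMajorant_nonneg (t : ℝ) : 0 ≤ jacobianMajorant t := by
  unfold jacobianMajorant; positivity

@[fun_prop]
theorem measurable_jacobianMajorant : Measurable jacobianMajorant := by
  unfold jacobianMajorant; fun_prop

theorem integrable_jacobianMajorant : Integrable jacobianMajorant := by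
  have hIoc : IntegrableOn jacobianMajorant (Set.Ioc 0 1) := by
    have h := (intervalIntegrable_iff_integrableOn_Ioc_of_le zero_le_one).1
      (intervalIntegral.intervalIntegrable_rpow' (a := 0) (b := 1) (r := -(1 / 2)) (by norm_num))
    refine Integrable.mono' h measurable_jacobianMajorant.aestronglyMeasurable ?_
    filter_upwards [ae_restrict_mem measurableSet_Ioc] with t ht
    rw [Real.norm_of_nonneg (jacobianMajorant_nonneg t)]
    refine Real.rpow_le_rpow_of_nonpos ht.1 ?_ (by norm_num)
    rw [abs_of_pos ht.1]
    nlinarith [ht.1, pow_pos ht.1 3]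
  have hIoi : IntegrableOn jacobianMajorant (Set.Ioi 1) := by
    have h := integrableOn_Ioi_rpow_of_lt (a := -(3 / 2)) (c := 1) (by norm_num) one_pos
    refine Integrable.mono' h measurable_jacobianMajorant.aestronglyMeasurable ?_
    filter_upwards [ae_restrict_mem measurableSet_Ioi] with t ht
    have ht0 : 0 < t := one_pos.trans ht
    rw [Real.norm_of_nonneg (jacobianMajorant_nonneg t),
      show (-(3 / 2) : ℝ) = (3 : ℕ) * (-(1 / 2)) by norm_num, Real.rpow_natCast_mul ht0.le]
    refine Real.rpow_le_rpow_of_nonpos (by positivity) ?_ (by norm_num)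
    rw [abs_of_pos ht0]
    nlinarith
  have hpos : IntegrableOn jacobianMajorant (Set.Ioi 0) := by
    rw [← Set.Ioc_union_Ioi_eq_Ioi zero_le_one]
    exact hIoc.union hIoi
  have hneg : IntegrableOn jacobianMajorant (Set.Iic 0) := by
    have h : IntegrableOn (fun t => jacobianMajorant (-t)) (Set.Iic 0) := by
      rw [integrableOn_Iic_iff_integrableOn_Iio]
      have := hpos
      rw [← neg_zero] at this
      exact this.comp_neg_Iio
    have heven : (fun t => jacobianMajorant (-t)) = jacobianMajorant := by
      ext t; simp only [jacobianMajorant, abs_neg, neg_sq]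
    rwa [heven] at h
  rw [← integrableOn_univ, ← Set.Iic_union_Ioi (a := (0 : ℝ))]
  exact hneg.union hpos

theorem rpow_le_jacobianMajorant {r t : ℝ} (ht : t ≠ 0) (h : |t| * (1 + t ^ 2) ≤ 6 * r) :
    r ^ (-(1 / 2) : ℝ) ≤ 3 * jacobianMajorant t := by
  have hpos : 0 < |t| * (1 + t ^ 2) := by positivity
  calc r ^ (-(1 / 2) : ℝ) ≤ (9⁻¹ * (|t| * (1 + t ^ 2))) ^ (-(1 / 2) : ℝ) :=
        Real.rpow_le_rpow_of_nonpos (by positivity) (by linarith) (by norm_num)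
    _ = 3 * jacobianMajorant t := by
        rw [Real.mul_rpow (by norm_num) hpos.le, jacobianMajorant]
        congr 1
        rw [show (9⁻¹ : ℝ) = 3 ^ (-2 : ℝ) by norm_num [Real.rpow_neg], ← Real.rpow_mul (by norm_num)]
        norm_num

/-- The total mass in `λ` of the two Jacobian majorants. -/
noncomputable def jacobianMass : ℝ≥0∞ :=
  ∫⁻ l, ENNReal.ofReal (3 * (jacobianMajorant l + jacobianMajorant (1 - l)))

theorem jacobianMass_lt_top : jacobianMass < ∞ :=
  ((integrable_jacobianMajorant.add
    (integrable_jacobianMajorant.comp_sub_left 1)).const_mul 3).lintegral_lt_top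

theorem lintegral_le_jacobianMass {g : ℝ × ℝ × ℝ → ℝ≥0∞} (hg : Measurable g) {A : ℝ≥0∞}
    (h : ∀ l : ℝ, l ≠ 0 → l ≠ 1 → ∫⁻ p : ℝ × ℝ, g (p.1, p.2, l) ≤
      A * ENNReal.ofReal (3 * (jacobianMajorant l + jacobianMajorant (1 - l)))) :
    ∫⁻ p, g p ≤ A * jacobianMass := by
  rw [← (volume_preserving_prodAssoc (α₁ := ℝ) (β₁ := ℝ) (γ₁ := ℝ)).lintegral_comp hg,
    Measure.volume_eq_prod, lintegral_prod_symm _ (by fun_prop), jacobianMass,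
    ← lintegral_const_mul _ (by fun_prop)]
  refine lintegral_mono_ae ?_
  filter_upwards [Measure.ae_ne volume 0, Measure.ae_ne volume 1] with l h0 h1
  exact h l h0 h1

theorem lintegral_le_of_det {w : ℝ → ℝ≥0∞} (hw : Measurable w) {r : ℝ} {l : ℝ}
    {a₁ b₁ a₂ b₂ a₃ b₃ a₄ b₄ : ℝ} (e₁ e₂ e₃ e₄ : ℝ)
    (hr : |(a₁ * b₂ - b₁ * a₂) * (a₃ * b₄ - b₃ * a₄)| = r) (hl₀ : l ≠ 0) (hl₁ : l ≠ 1)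
    (h : |l| * (1 + l ^ 2) ≤ 6 * r ∨ |1 - l| * (1 + (1 - l) ^ 2) ≤ 6 * r) :
    ∫⁻ p : ℝ × ℝ, w (a₁ * p.1 + b₁ * p.2 + e₁) * w (a₂ * p.1 + b₂ * p.2 + e₂) *
        (w (a₃ * p.1 + b₃ * p.2 + e₃) * w (a₄ * p.1 + b₄ * p.2 + e₄)) ≤
      (∫⁻ t, w t ^ (2 : ℝ)) ^ 2 *
        ENNReal.ofReal (3 * (jacobianMajorant l + jacobianMajorant (1 - l))) := by
  have hl₁' : 1 - l ≠ 0 := sub_ne_zero.2 hl₁.symm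
  have hr0 : 0 < r := by
    rcases h with h | h
    · have : 0 < |l| * (1 + l ^ 2) := by positivity
      linarith
    · have : 0 < |1 - l| * (1 + (1 - l) ^ 2) := by positivity
      linarith
  have hne := abs_pos.1 (hr ▸ hr0)
  refine (lintegral_four_affine_le hw e₁ e₂ e₃ e₄ (left_ne_zero_of_mul hne)
    (right_ne_zero_of_mul hne)).trans ?_
  rw [hr]
  gcongr
  have h₀ := jacobianMajorant_nonneg l
  have h₁ := jacobianMajorant_nonneg (1 - l)
  rcases h with h | h
  · linarith [rpow_le_jacobianMajorant hl₀ h]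
  · linarith [rpow_le_jacobianMajorant hl₁' h]

theorem lintegral_weights_le {w : ℝ → ℝ≥0∞} (hw : Measurable w) (x : ℝ) :
    ∫⁻ p : ℝ × ℝ × ℝ,
      (w (p.2.2 * p.1 + x) * w (p.2.2 * x + p.2.1 - p.2.2 * p.2.1) +
        w (p.1 + p.2.1) * w (p.2.2 * x + p.2.1 - p.2.2 * p.2.1) +
        w (p.1 + p.2.1) * w (p.2.2 * p.1 + x)) *
      (w (p.2.2 * p.1 + p.2.1) * w (p.1 + p.2.2 * x + p.2.1 - p.2.2 * p.2.1)) ≤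
    3 * ((∫⁻ t, w t ^ (2 : ℝ)) ^ 2 * jacobianMass) := by
  have hD : ∀ l : ℝ, |l * (1 - l) - 1 * 1| = 1 - l + l ^ 2 := fun l => by
    rw [abs_of_nonpos] <;> nlinarith [sq_nonneg (l - 1 / 2)]
  simp only [add_mul]
  rw [lintegral_add_left (by fun_prop), lintegral_add_left (by fun_prop),
    show ∀ u : ℝ≥0∞, 3 * u = u + u + u by intro u; ring]
  gcongr
  · refine lintegral_le_jacobianMass (by fun_prop) fun l h0 h1 => ?_
    refine le_of_eq_of_le ?_ (lintegral_le_of_det hw (l := l) (a₁ := l) (b₁ := 0) (a₂ := 0)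
      (b₂ := 1 - l) (a₃ := l) (b₃ := 1) (a₄ := 1) (b₄ := 1 - l) x (l * x) 0 (l * x) rfl h0 h1 ?_)
    · refine lintegral_congr fun p => ?_
      congr! 3 <;> ring
    · rw [abs_mul, hD, zero_mul, sub_zero, abs_mul]
      rcases le_total (1 / 2) |l| with h | h
      · right
        nlinarith [mul_nonneg (sub_nonneg.2 h) (mul_nonneg (abs_nonneg (1 - l))
          (by nlinarith [sq_nonneg (l - 1 / 2)] : 0 ≤ 1 - l + l ^ 2)),
          mul_nonneg (abs_nonneg (1 - l))
          (by nlinarith [sq_nonneg (l - 1 / 4)] : 0 ≤ 3 * (1 - l + l ^ 2) - (1 + (1 - l) ^ 2))]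
      · left
        have h' : 1 / 2 ≤ |1 - l| := by
          have := abs_sub_abs_le_abs_sub 1 l
          rw [abs_one] at this
          linarith
        nlinarith [mul_nonneg (sub_nonneg.2 h') (mul_nonneg (abs_nonneg l)
          (by nlinarith [sq_nonneg (l - 1 / 2)] : 0 ≤ 1 - l + l ^ 2)),
          mul_nonneg (abs_nonneg l)
          (by nlinarith [sq_nonneg (l - 3 / 4)] : 0 ≤ 3 * (1 - l + l ^ 2) - (1 + l ^ 2))]
  · refine lintegral_le_jacobianMass (by fun_prop) fun l h0 h1 => ?_
    refine le_of_eq_of_le ?_ (lintegral_le_of_det hw (l := l) (a₁ := 1) (b₁ := 1) (a₂ := 0)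
      (b₂ := 1 - l) (a₃ := l) (b₃ := 1) (a₄ := 1) (b₄ := 1 - l) 0 (l * x) 0 (l * x) rfl h0 h1 ?_)
    · refine lintegral_congr fun p => ?_
      congr! 3 <;> ring
    · right
      rw [abs_mul, hD, mul_zero, sub_zero, one_mul]
      nlinarith [mul_nonneg (abs_nonneg (1 - l))
        (by nlinarith [sq_nonneg (l - 1 / 2)] : 0 ≤ 6 * (1 - l + l ^ 2) - (1 + (1 - l) ^ 2))]
  · refine lintegral_le_jacobianMass (by fun_prop) fun l h0 h1 => ?_
    refine le_of_eq_of_le ?_ (lintegral_le_of_det hw (l := l) (a₁ := 1) (b₁ := 1) (a₂ := l)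
      (b₂ := 0) (a₃ := l) (b₃ := 1) (a₄ := 1) (b₄ := 1 - l) 0 x 0 (l * x) rfl h0 h1 ?_)
    · refine lintegral_congr fun p => ?_
      congr! 3 <;> ring
    · left
      rw [abs_mul, hD, mul_zero, zero_sub, one_mul, abs_neg]
      nlinarith [mul_nonneg (abs_nonneg l)
        (by nlinarith [sq_nonneg (l - 1 / 2)] : 0 ≤ 6 * (1 - l + l ^ 2) - (1 + l ^ 2))]

theorem jap_pos (t : ℝ) : 0 < jap t := by unfold jap; positivity

@[fun_prop]
theorem measurable_jap : Measurable jap := by unfold jap; fun_prop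

theorem jap_sq (t : ℝ) : jap t ^ 2 = 1 + t ^ 2 := Real.sq_sqrt (by positivity)

theorem jap_rpow_le {s : ℝ} (hs : 0 ≤ s) {x a b c : ℝ} (h : x ^ 2 ≤ a ^ 2 + b ^ 2 + c ^ 2) :
    jap x ^ s ≤ 3 ^ s * (jap a ^ s + jap b ^ s + jap c ^ s) := by
  have key : ∀ {m}, 0 < m → jap a ≤ m → jap b ≤ m → jap c ≤ m → jap x ^ s ≤ 3 ^ s * m ^ s := by
    intro m hm ha hb hc
    rw [← Real.mul_rpow (by norm_num) hm.le]
    refine Real.rpow_le_rpow (jap_pos x).le (abs_le_of_sq_le_sq' ?_ (by positivity)).2 hs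
    nlinarith [jap_sq a, jap_sq b, jap_sq c, jap_sq x, pow_le_pow_left₀ (jap_pos a).le ha 2,
      pow_le_pow_left₀ (jap_pos b).le hb 2, pow_le_pow_left₀ (jap_pos c).le hc 2]
  have ha := Real.rpow_nonneg (jap_pos a).le s
  have hb := Real.rpow_nonneg (jap_pos b).le s
  have hc := Real.rpow_nonneg (jap_pos c).le s
  obtain ⟨m, hm, hle, ha', hb', hc'⟩ : ∃ m, 0 < m ∧
      m ^ s ≤ jap a ^ s + jap b ^ s + jap c ^ s ∧ jap a ≤ m ∧ jap b ≤ m ∧ jap c ≤ m := by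
    rcases le_total (jap a) (jap b) with hab | hab
    · rcases le_total (jap b) (jap c) with hbc | hbc
      · exact ⟨jap c, jap_pos c, by linarith, hab.trans hbc, hbc, le_rfl⟩
      · exact ⟨jap b, jap_pos b, by linarith, hab, le_rfl, hbc⟩
    · rcases le_total (jap a) (jap c) with hac | hac
      · exact ⟨jap c, jap_pos c, by linarith, hac, hab.trans hac, le_rfl⟩
      · exact ⟨jap a, jap_pos a, by linarith, le_rfl, hab, hac⟩
  exact (key hm ha' hb' hc').trans (by gcongr)

theorem lintegral_jap_rpow_lt_top {s : ℝ} (hs : 1 / 2 < s) :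
    ∫⁻ t, ENNReal.ofReal (jap t ^ (-s)) ^ (2 : ℝ) < ∞ := by
  have h := (integrable_rpow_neg_one_add_norm_sq (E := ℝ) (μ := volume) (r := 2 * s)
    (by rw [Module.finrank_self]; norm_num; linarith)).lintegral_lt_top
  convert h using 3 with t
  have ht := jap_pos t
  rw [ENNReal.ofReal_rpow_of_nonneg (by positivity) (by norm_num), ← Real.rpow_mul ht.le, jap,
    Real.sqrt_eq_rpow, ← Real.rpow_mul (by positivity), Real.norm_eq_abs, sq_abs]
  congr 2
  ring

theorem norm_le_of_jap_mul_le {s M t : ℝ} {z : ℂ} (h : jap t ^ s * ‖z‖ ≤ M) :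
    ‖z‖ ≤ M * jap t ^ (-s) := by
  rwa [Real.rpow_neg (jap_pos t).le, ← div_eq_mul_inv,
    le_div_iff₀' (Real.rpow_pos_of_pos (jap_pos t) s)]

theorem sq_le_sum_sq_of_resonant (x β ξ l : ℝ) :
    x ^ 2 ≤ (β + ξ) ^ 2 + (l * β + x) ^ 2 + (l * x + ξ - l * ξ) ^ 2 := by
  have h : (β + ξ) ^ 2 + (l * β + x) ^ 2 + (l * x + ξ - l * ξ) ^ 2 =
      (l * β + ξ) ^ 2 + (β + l * x + ξ - l * ξ) ^ 2 + x ^ 2 := by ring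
  rw [h]
  linarith [sq_nonneg (l * β + ξ), sq_nonneg (β + l * x + ξ - l * ξ)]

theorem jap_rpow_mul_prod_le {s : ℝ} (hs : 0 ≤ s) {x a b c d e : ℝ}
    (h : x ^ 2 ≤ a ^ 2 + b ^ 2 + c ^ 2) :
    jap x ^ s * (jap a ^ (-s) * jap b ^ (-s) * jap c ^ (-s) * (jap d ^ (-s) * jap e ^ (-s))) ≤
      3 ^ s * ((jap b ^ (-s) * jap c ^ (-s) + jap a ^ (-s) * jap c ^ (-s) +
        jap a ^ (-s) * jap b ^ (-s)) * (jap d ^ (-s) * jap e ^ (-s))) := by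
  have hw : ∀ t, 0 < jap t ^ (-s) := fun t => Real.rpow_pos_of_pos (jap_pos t) _
  have hv : ∀ t, jap t ^ s * jap t ^ (-s) = 1 := fun t => by
    rw [← Real.rpow_add (jap_pos t), add_neg_cancel, Real.rpow_zero]
  have ha := hw a
  have hb := hw b
  have hc := hw c
  have hd := hw d
  have he := hw e
  refine (mul_le_mul_of_nonneg_right (jap_rpow_le hs h) (by positivity)).trans_eq ?_
  linear_combination (3 : ℝ) ^ s * (jap d ^ (-s) * jap e ^ (-s)) *
    (jap b ^ (-s) * jap c ^ (-s) * hv a + jap a ^ (-s) * jap c ^ (-s) * hv b +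
      jap a ^ (-s) * jap b ^ (-s) * hv c)

theorem jap_rpow_mul_norm_le {s : ℝ} (hs : 0 ≤ s) {M₁ M₂ M₃ M₄ M₅ x a b c d e : ℝ}
    {z₁ z₂ z₃ z₄ z₅ : ℂ} (h : x ^ 2 ≤ a ^ 2 + b ^ 2 + c ^ 2)
    (h₁ : jap a ^ s * ‖z₁‖ ≤ M₁) (h₂ : jap b ^ s * ‖z₂‖ ≤ M₂) (h₃ : jap c ^ s * ‖z₃‖ ≤ M₃)
    (h₄ : jap d ^ s * ‖z₄‖ ≤ M₄) (h₅ : jap e ^ s * ‖z₅‖ ≤ M₅) :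
    jap x ^ s * ‖z₁ * z₂ * z₃ * conj (z₄ * z₅)‖ ≤
      M₁ * M₂ * M₃ * M₄ * M₅ * 3 ^ s *
        ((jap b ^ (-s) * jap c ^ (-s) + jap a ^ (-s) * jap c ^ (-s) +
          jap a ^ (-s) * jap b ^ (-s)) * (jap d ^ (-s) * jap e ^ (-s))) := by
  have hM : ∀ {t M : ℝ} {z : ℂ}, jap t ^ s * ‖z‖ ≤ M → 0 ≤ M := fun {t _ _} h =>
    (mul_nonneg (Real.rpow_nonneg (jap_pos t).le s) (norm_nonneg _)).trans h
  have hw : ∀ t, 0 ≤ jap t ^ (-s) := fun t => Real.rpow_nonneg (jap_pos t).le _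
  have hM₁ := hM h₁
  have hM₂ := hM h₂
  have hM₃ := hM h₃
  have hM₄ := hM h₄
  have hM₅ := hM h₅
  have ha := hw a
  have hb := hw b
  have hc := hw c
  have hd := hw d
  have he := hw e
  have hx := Real.rpow_nonneg (jap_pos x).le s
  rw [norm_mul, norm_mul, norm_mul, RCLike.norm_conj, norm_mul]
  calc jap x ^ s * (‖z₁‖ * ‖z₂‖ * ‖z₃‖ * (‖z₄‖ * ‖z₅‖))
      ≤ jap x ^ s * ((M₁ * jap a ^ (-s)) * (M₂ * jap b ^ (-s)) * (M₃ * jap c ^ (-s)) *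
          ((M₄ * jap d ^ (-s)) * (M₅ * jap e ^ (-s)))) := by
        gcongr <;> exact norm_le_of_jap_mul_le ‹_›
    _ = M₁ * M₂ * M₃ * M₄ * M₅ * (jap x ^ s * (jap a ^ (-s) * jap b ^ (-s) * jap c ^ (-s) *
          (jap d ^ (-s) * jap e ^ (-s)))) := by ring
    _ ≤ _ := by
        rw [mul_assoc _ ((3 : ℝ) ^ s)]
        exact mul_le_mul_of_nonneg_left (jap_rpow_mul_prod_le hs h) (by positivity)

theorem ofReal_pair_sums {a b c d e : ℝ} (ha : 0 ≤ a) (hb : 0 ≤ b) (hc : 0 ≤ c) (hd : 0 ≤ d) :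
    ENNReal.ofReal ((b * c + a * c + a * b) * (d * e)) =
      (ENNReal.ofReal b * ENNReal.ofReal c + ENNReal.ofReal a * ENNReal.ofReal c +
        ENNReal.ofReal a * ENNReal.ofReal b) * (ENNReal.ofReal d * ENNReal.ofReal e) := by
  simp only [← ENNReal.ofReal_mul ha, ← ENNReal.ofReal_mul hb, ← ENNReal.ofReal_mul hd]
  rw [← ENNReal.ofReal_add (by positivity) (by positivity),
    ← ENNReal.ofReal_add (by positivity) (by positivity), ← ENNReal.ofReal_mul (by positivity)]

theorem stmt12 (s : ℝ) (hs : 1 / 2 < s) :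
    ∃ C : ℝ, 0 < C ∧
      ∀ (f₁ f₂ f₃ f₄ f₅ : ℝ → ℂ) (M₁ M₂ M₃ M₄ M₅ : ℝ),
        Measurable f₁ → Measurable f₂ → Measurable f₃ → Measurable f₄ → Measurable f₅ →
        (∀ t, jap t ^ s * ‖f₁ t‖ ≤ M₁) → (∀ t, jap t ^ s * ‖f₂ t‖ ≤ M₂) →
        (∀ t, jap t ^ s * ‖f₃ t‖ ≤ M₃) → (∀ t, jap t ^ s * ‖f₄ t‖ ≤ M₄) →
        (∀ t, jap t ^ s * ‖f₅ t‖ ≤ M₅) →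
        (∀ x : ℝ, Integrable (fun p : ℝ × ℝ × ℝ =>
          f₁ (p.1 + p.2.1) * f₂ (p.2.2 * p.1 + x) *
            f₃ (p.2.2 * x + p.2.1 - p.2.2 * p.2.1) *
            conj (f₄ (p.2.2 * p.1 + p.2.1) *
              f₅ (p.1 + p.2.2 * x + p.2.1 - p.2.2 * p.2.1))) volume) ∧
        ∀ x : ℝ, jap x ^ s * ‖T6 f₁ f₂ f₃ f₄ f₅ x‖ ≤ C * (M₁ * M₂ * M₃ * M₄ * M₅) := by
  have hs0 : 0 ≤ s := by linarith
  set w : ℝ → ℝ≥0∞ := fun t => ENNReal.ofReal (jap t ^ (-s))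
  have hw : Measurable w := by fun_prop
  set K : ℝ≥0∞ := 3 * ((∫⁻ t, w t ^ (2 : ℝ)) ^ 2 * jacobianMass)
  have hK : K ≠ ∞ := ENNReal.mul_ne_top (by norm_num) (ENNReal.mul_ne_top
    (ENNReal.pow_ne_top (lintegral_jap_rpow_lt_top hs).ne) jacobianMass_lt_top.ne)
  refine ⟨3 / π ^ 2 * (3 ^ s * K.toReal) + 1, by positivity, ?_⟩
  intro f₁ f₂ f₃ f₄ f₅ M₁ M₂ M₃ M₄ M₅ m₁ m₂ m₃ m₄ m₅ h₁ h₂ h₃ h₄ h₅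
  have hM : ∀ {f : ℝ → ℂ} {M : ℝ}, (∀ t, jap t ^ s * ‖f t‖ ≤ M) → 0 ≤ M := fun h =>
    (mul_nonneg (Real.rpow_nonneg (jap_pos 0).le s) (norm_nonneg _)).trans (h 0)
  have hM₁ := hM h₁
  have hM₂ := hM h₂
  have hM₃ := hM h₃
  have hM₄ := hM h₄
  have hM₅ := hM h₅
  set F : ℝ → ℝ × ℝ × ℝ → ℂ := fun x p =>
    f₁ (p.1 + p.2.1) * f₂ (p.2.2 * p.1 + x) * f₃ (p.2.2 * x + p.2.1 - p.2.2 * p.2.1) *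
      conj (f₄ (p.2.2 * p.1 + p.2.1) * f₅ (p.1 + p.2.2 * x + p.2.1 - p.2.2 * p.2.1))
  have hFm : ∀ x, Measurable (F x) := fun x =>
    Measurable.mul (by fun_prop) (Complex.continuous_conj.measurable.comp (by fun_prop))
  set B : ℝ := M₁ * M₂ * M₃ * M₄ * M₅ * 3 ^ s with hB
  have hB0 : 0 ≤ B := by positivity
  have hbound : ∀ x, ENNReal.ofReal (jap x ^ s) * ∫⁻ p, ‖F x p‖ₑ ≤ ENNReal.ofReal B * K := by
    intro x
    rw [← lintegral_const_mul _ (hFm x).enorm]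
    refine le_trans ?_ (mul_le_mul_right (lintegral_weights_le hw x) _)
    rw [← lintegral_const_mul _ (by fun_prop)]
    refine lintegral_mono fun p => ?_
    have hwn : ∀ t, 0 ≤ jap t ^ (-s) := fun t => Real.rpow_nonneg (jap_pos t).le _
    have hp := ENNReal.ofReal_le_ofReal (jap_rpow_mul_norm_le hs0
      (sq_le_sum_sq_of_resonant x p.1 p.2.1 p.2.2) (h₁ _) (h₂ _) (h₃ _)
      (h₄ (p.2.2 * p.1 + p.2.1)) (h₅ (p.1 + p.2.2 * x + p.2.1 - p.2.2 * p.2.1)))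
    rwa [ENNReal.ofReal_mul (Real.rpow_nonneg (jap_pos x).le s), ofReal_norm, ← hB,
      ENNReal.ofReal_mul hB0, ofReal_pair_sums (hwn _) (hwn _) (hwn _) (hwn _)] at hp
  have hint : ∀ x, Integrable (F x) := by
    refine fun x => ⟨(hFm x).aestronglyMeasurable, ?_⟩
    have hlt := (hbound x).trans_lt (ENNReal.mul_lt_top ENNReal.ofReal_lt_top hK.lt_top)
    exact ENNReal.lt_top_of_mul_ne_top_right hlt.ne
      (ENNReal.ofReal_pos.2 (Real.rpow_pos_of_pos (jap_pos x) s)).ne'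
  refine ⟨hint, fun x => ?_⟩
  have hx := Real.rpow_nonneg (jap_pos x).le s
  have hI : jap x ^ s * ‖∫ p, F x p‖ ≤ B * K.toReal := by
    rw [← ENNReal.ofReal_le_ofReal_iff (by positivity), ENNReal.ofReal_mul hx, ofReal_norm,
      ENNReal.ofReal_mul hB0, ENNReal.ofReal_toReal hK]
    exact (mul_le_mul_right (enorm_integral_le_lintegral_enorm _) _).trans (hbound x)
  calc jap x ^ s * ‖T6 f₁ f₂ f₃ f₄ f₅ x‖ = 3 / π ^ 2 * (jap x ^ s * ‖∫ p, F x p‖) := by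
        rw [T6, norm_mul, Complex.norm_real, Real.norm_of_nonneg (by positivity)]
        ring
    _ ≤ 3 / π ^ 2 * (B * K.toReal) := by gcongr
    _ ≤ (3 / π ^ 2 * (3 ^ s * K.toReal) + 1) * (M₁ * M₂ * M₃ * M₄ * M₅) := by
        have : 0 ≤ M₁ * M₂ * M₃ * M₄ * M₅ := by positivity
        rw [hB]
        linarith
end

section
/- Let μ > 0 and ε > 0, and let G_{μ,ε}(x) = exp( μx² / (1 + εx²) ). Let A : ℝ³ → ℝ³ be a linear isometry and let f₁, …, f₆ : ℝ → [0,∞) be measurable. Then, with integrals taken in [0,∞], ∫_{ℝ³} f₁((Ax)₁) f₂((Ax)₂) f₃((Ax)₃) f₄(x₁) f₅(x₂) f₆(x₃) G_{μ,ε}(x₃) dx ≤ ∫_{ℝ³} f₁((Ax)₁)G_{μ,ε}((Ax)₁) f₂((Ax)₂)G_{μ,ε}((Ax)₂) f₃((Ax)₃)G_{μ,ε}((Ax)₃) f₄(x₁)G_{μ,ε}(x₁) f₅(x₂)G_{μ,ε}(x₂) f₆(x₃) dx. That is, the exponential weight G_{μ,ε} on the last argument can be transferred to the other five arguments. -/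
open MeasureTheory Matrix
open scoped ENNReal

/-- The exponential weight `G_{μ,ε}(x) = exp(μx²/(1+εx²))`. -/
noncomputable def Gweight (μ ε x : ℝ) : ℝ := Real.exp (μ * x ^ 2 / (1 + ε * x ^ 2))

lemma one_le_Gweight {μ ε : ℝ} (hμ : 0 < μ) (hε : 0 < ε) (x : ℝ) : 1 ≤ Gweight μ ε x :=
  Real.one_le_exp (by positivity)

/-- The exponent of `Gweight` is increasing and subadditive as a function of `x ^ 2`. -/
lemma Gweight_le_mul_of_sq_le {μ ε a b c d : ℝ} (hμ : 0 < μ) (hε : 0 < ε)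
    (h : d ^ 2 ≤ a ^ 2 + b ^ 2 + c ^ 2) :
    Gweight μ ε d ≤ Gweight μ ε a * Gweight μ ε b * Gweight μ ε c := by
  unfold Gweight
  rw [← Real.exp_add, ← Real.exp_add, Real.exp_le_exp]
  set s := a ^ 2 + b ^ 2 + c ^ 2 with hs
  have hs0 : 0 ≤ s := by positivity
  have mono : μ * d ^ 2 / (1 + ε * d ^ 2) ≤ μ * s / (1 + ε * s) := by
    rw [div_le_div_iff₀ (by positivity) (by positivity)]
    have := mul_le_mul_of_nonneg_left h hμ.le
    linarith
  have term : ∀ t : ℝ, t ^ 2 ≤ s → μ * t ^ 2 / (1 + ε * s) ≤ μ * t ^ 2 / (1 + ε * t ^ 2) := by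
    intro t ht
    gcongr
  have ha := term a (by nlinarith)
  have hb := term b (by nlinarith)
  have hc := term c (by nlinarith)
  have split : μ * s / (1 + ε * s) =
      μ * a ^ 2 / (1 + ε * s) + μ * b ^ 2 / (1 + ε * s) + μ * c ^ 2 / (1 + ε * s) := by
    rw [← add_div, ← add_div, hs]
    ring
  linarith

lemma sum_mulVec_sq_eq {n : Type*} [Fintype n] [DecidableEq n] {A : Matrix n n ℝ}
    (hA : Aᵀ * A = 1) (x : n → ℝ) : ∑ i, A.mulVec x i ^ 2 = ∑ i, x i ^ 2 := by
  have h : A.mulVec x ⬝ᵥ A.mulVec x = x ⬝ᵥ x := by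
    rw [dotProduct_mulVec, ← mulVec_transpose, mulVec_mulVec, hA, one_mulVec]
  simpa [dotProduct, sq] using h

theorem stmt14 (μ ε : ℝ) (hμ : 0 < μ) (hε : 0 < ε)
    (A : Matrix (Fin 3) (Fin 3) ℝ) (hA : Aᵀ * A = 1)
    (f₁ f₂ f₃ f₄ f₅ f₆ : ℝ → ℝ)
    (hm₁ : Measurable f₁) (hm₂ : Measurable f₂) (hm₃ : Measurable f₃)
    (hm₄ : Measurable f₄) (hm₅ : Measurable f₅) (hm₆ : Measurable f₆)
    (h₁ : ∀ t, 0 ≤ f₁ t) (h₂ : ∀ t, 0 ≤ f₂ t) (h₃ : ∀ t, 0 ≤ f₃ t)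
    (h₄ : ∀ t, 0 ≤ f₄ t) (h₅ : ∀ t, 0 ≤ f₅ t) (h₆ : ∀ t, 0 ≤ f₆ t) :
    (∫⁻ x : Fin 3 → ℝ,
        ENNReal.ofReal (f₁ (A.mulVec x 0) * f₂ (A.mulVec x 1) * f₃ (A.mulVec x 2) *
          f₄ (x 0) * f₅ (x 1) * (f₆ (x 2) * Gweight μ ε (x 2))))
      ≤ ∫⁻ x : Fin 3 → ℝ,
          ENNReal.ofReal ((f₁ (A.mulVec x 0) * Gweight μ ε (A.mulVec x 0)) *
            (f₂ (A.mulVec x 1) * Gweight μ ε (A.mulVec x 1)) *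
            (f₃ (A.mulVec x 2) * Gweight μ ε (A.mulVec x 2)) *
            (f₄ (x 0) * Gweight μ ε (x 0)) * (f₅ (x 1) * Gweight μ ε (x 1)) *
            f₆ (x 2)) := by
  refine lintegral_mono fun x => ENNReal.ofReal_le_ofReal ?_
  have hsq := sum_mulVec_sq_eq hA x
  simp only [Fin.sum_univ_three] at hsq
  have hG := Gweight_le_mul_of_sq_le (μ := μ) hμ hε
    (show x 2 ^ 2 ≤ A.mulVec x 0 ^ 2 + A.mulVec x 1 ^ 2 + A.mulVec x 2 ^ 2 by
      nlinarith [sq_nonneg (x 0), sq_nonneg (x 1)])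
  have hG₀₁ : 1 ≤ Gweight μ ε (x 0) * Gweight μ ε (x 1) :=
    one_le_mul_of_one_le_of_one_le (one_le_Gweight hμ hε _) (one_le_Gweight hμ hε _)
  have hle := hG.trans (le_mul_of_one_le_right ((Real.exp_pos _).le.trans hG) hG₀₁)
  have hF : 0 ≤ f₁ (A.mulVec x 0) * f₂ (A.mulVec x 1) * f₃ (A.mulVec x 2) *
      f₄ (x 0) * f₅ (x 1) * f₆ (x 2) := by
    have := h₁ (A.mulVec x 0)
    have := h₂ (A.mulVec x 1)
    have := h₃ (A.mulVec x 2)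
    have := h₄ (x 0)
    have := h₅ (x 1)
    have := h₆ (x 2)
    positivity
  have := mul_le_mul_of_nonneg_left hle hF
  linarith
end

section
/- For n ≥ 0 let φₙ(x) = Hₙ(x) e^{−x²/2}, where Hₙ is the n-th physicists' Hermite polynomial (defined by Hₙ(x) = (−1)ⁿ e^{x²} (d/dx)ⁿ e^{−x²}). Then φₙ is a stationary wave of the quintic resonant system: there exists ωₙ ∈ ℝ such that 𝓣₆(φₙ, φₙ, φₙ, φₙ, φₙ)(x) = ωₙ φₙ(x) for all x ∈ ℝ. -/
open MeasureTheory
open scoped ENNReal ComplexConjugate Real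

/-- The `n`-th physicists' Hermite polynomial,
`Hₙ(x) = (−1)ⁿ e^{x²} (d/dx)ⁿ e^{−x²}`. -/
noncomputable def physHermite (n : ℕ) (x : ℝ) : ℝ :=
  (-1 : ℝ) ^ n * Real.exp (x ^ 2) * iteratedDeriv n (fun t : ℝ => Real.exp (-t ^ 2)) x

/-- The `n`-th Hermite function `φₙ(x) = Hₙ(x) e^{−x²/2}`. -/
noncomputable def hermiteFun (n : ℕ) (x : ℝ) : ℂ :=
  ((physHermite n x * Real.exp (-x ^ 2 / 2) : ℝ) : ℂ)

/-- The physicists' Hermite polynomials, as elements of `ℝ[X]`. -/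
noncomputable def hermitePoly : ℕ → Polynomial ℝ
  | 0 => 1
  | n + 1 => 2 * Polynomial.X * hermitePoly n - Polynomial.derivative (hermitePoly n)

theorem natDegree_hermitePoly_le (n : ℕ) : (hermitePoly n).natDegree ≤ n := by
  induction n with
  | zero => simp [hermitePoly]
  | succ n ih =>
    rw [hermitePoly]
    refine (Polynomial.natDegree_sub_le _ _).trans (max_le ?_ ?_)
    · have h : (2 * Polynomial.X : Polynomial ℝ).natDegree ≤ 1 := by compute_degree
      exact (Polynomial.natDegree_mul_le_of_le h ih).trans_eq (add_comm _ _)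
    · exact (Polynomial.natDegree_derivative_le _).trans (by omega)

theorem hasDerivAt_eval_mul_exp_neg_sq (p : Polynomial ℝ) (x : ℝ) :
    HasDerivAt (fun t => p.eval t * Real.exp (-t ^ 2))
      (-((2 * Polynomial.X * p - Polynomial.derivative p).eval x * Real.exp (-x ^ 2))) x := by
  have h := (p.hasDerivAt x).mul ((hasDerivAt_id x).pow 2).neg.exp
  refine h.congr_deriv ?_
  simp only [id, Pi.pow_apply, Pi.neg_apply, Polynomial.eval_sub,
    Polynomial.eval_mul, Polynomial.eval_X, Polynomial.eval_ofNat]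
  push_cast
  ring

theorem iteratedDeriv_exp_neg_sq (n : ℕ) :
    iteratedDeriv n (fun t : ℝ => Real.exp (-t ^ 2)) =
      fun x => (-1) ^ n * ((hermitePoly n).eval x * Real.exp (-x ^ 2)) := by
  induction n with
  | zero => simp [hermitePoly]
  | succ n ih =>
    ext x
    rw [iteratedDeriv_succ, ih,
      ((hasDerivAt_eval_mul_exp_neg_sq (hermitePoly n) x).const_mul _).deriv, hermitePoly]
    ring

theorem physHermite_eq_eval (n : ℕ) (x : ℝ) : physHermite n x = (hermitePoly n).eval x := by
  have h1 : ((-1 : ℝ) ^ n) * (-1) ^ n = 1 := by rw [← mul_pow]; simp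
  have h2 : Real.exp (x ^ 2) * Real.exp (-x ^ 2) = 1 := by rw [← Real.exp_add]; simp
  rw [physHermite, iteratedDeriv_exp_neg_sq]
  linear_combination (hermitePoly n).eval x * Real.exp (x ^ 2) * Real.exp (-x ^ 2) * h1 +
    (hermitePoly n).eval x * h2

theorem exists_abs_eval_mul_exp_neg_mul_sq_le (p : Polynomial ℝ) {b : ℝ} (hb : 0 < b) :
    ∃ C, ∀ x : ℝ, |p.eval x * Real.exp (-b * x ^ 2)| ≤ C := by
  induction p using Polynomial.induction_on' with
  | add p q hp hq =>
    obtain ⟨C, hC⟩ := hp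
    obtain ⟨D, hD⟩ := hq
    refine ⟨C + D, fun x => ?_⟩
    rw [Polynomial.eval_add, add_mul]
    exact (abs_add_le _ _).trans (add_le_add (hC x) (hD x))
  | monomial k a =>
    refine ⟨|a| * (k.factorial * Real.exp (1 / (4 * b))), fun x => ?_⟩
    rw [Polynomial.eval_monomial, mul_assoc, abs_mul, abs_mul, abs_pow, Real.abs_exp]
    refine mul_le_mul_of_nonneg_left ?_ (abs_nonneg a)
    have h1 : |x| ^ k ≤ k.factorial * Real.exp |x| := by
      have := Real.pow_div_factorial_le_exp |x| (abs_nonneg x) k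
      rwa [div_le_iff₀' (by positivity)] at this
    have h2 : |x| + -b * x ^ 2 ≤ 1 / (4 * b) := by
      rw [le_div_iff₀ (by positivity), ← sq_abs x]
      nlinarith [sq_nonneg (2 * b * |x| - 1)]
    calc |x| ^ k * Real.exp (-b * x ^ 2)
        ≤ k.factorial * Real.exp |x| * Real.exp (-b * x ^ 2) := by gcongr
      _ = k.factorial * Real.exp (|x| + -b * x ^ 2) := by rw [Real.exp_add]; ring
      _ ≤ k.factorial * Real.exp (1 / (4 * b)) := by gcongr

theorem integrable_eval_mul_exp_neg_mul_sq (p : Polynomial ℝ) {b : ℝ} (hb : 0 < b) :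
    Integrable fun x : ℝ => p.eval x * Real.exp (-b * x ^ 2) := by
  obtain ⟨C, hC⟩ := exists_abs_eval_mul_exp_neg_mul_sq_le p (half_pos hb)
  refine ((integrable_exp_neg_mul_sq (half_pos hb)).const_mul C).mono'
    (by fun_prop) (.of_forall fun x => ?_)
  have h : Real.exp (-b * x ^ 2) = Real.exp (-(b / 2) * x ^ 2) * Real.exp (-(b / 2) * x ^ 2) := by
    rw [← Real.exp_add]; ring_nf
  rw [h, ← mul_assoc, norm_mul, Real.norm_eq_abs, Real.norm_eq_abs, Real.abs_exp]
  gcongr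
  exact hC x

theorem integrable_eval_mul_exp_neg_sq (p : Polynomial ℝ) :
    Integrable fun x : ℝ => p.eval x * Real.exp (-x ^ 2) := by
  simpa using integrable_eval_mul_exp_neg_mul_sq p one_pos

theorem integral_two_mul_X_mul_sub_derivative (p : Polynomial ℝ) :
    ∫ x : ℝ, (2 * Polynomial.X * p - Polynomial.derivative p).eval x * Real.exp (-x ^ 2) = 0 := by
  have h := integral_eq_zero_of_hasDerivAt_of_integrable (hasDerivAt_eval_mul_exp_neg_sq p)
    (integrable_eval_mul_exp_neg_sq _).neg (integrable_eval_mul_exp_neg_sq p)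
  rwa [integral_neg, neg_eq_zero] at h

theorem integral_hermitePoly_mul_eq_zero {n : ℕ} {q : Polynomial ℝ} (hq : q.degree < n) :
    ∫ x : ℝ, (hermitePoly n * q).eval x * Real.exp (-x ^ 2) = 0 := by
  induction n generalizing q with
  | zero =>
    have : q = 0 := by
      rw [← Polynomial.degree_eq_bot]
      exact Nat.WithBot.lt_zero_iff.1 (by simpa using hq)
    simp [this]
  | succ n ih =>
    have hq' : (Polynomial.derivative q).degree < n := by
      rw [Polynomial.degree_lt_iff_coeff_zero] at hq ⊢
      intro m hm
      rw [Polynomial.coeff_derivative, hq (m + 1) (by omega), zero_mul]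
    have h : hermitePoly (n + 1) * q =
        (2 * Polynomial.X * (hermitePoly n * q) - Polynomial.derivative (hermitePoly n * q)) +
          hermitePoly n * Polynomial.derivative q := by
      rw [hermitePoly, Polynomial.derivative_mul]; ring
    simp only [h, Polynomial.eval_add (p := _ - _), add_mul (_ : ℝ)]
    rw [integral_add (integrable_eval_mul_exp_neg_sq _) (integrable_eval_mul_exp_neg_sq _),
      integral_two_mul_X_mul_sub_derivative, ih hq', add_zero]

theorem integral_hermitePoly_mul_hermitePoly {m n : ℕ} (hmn : m ≠ n) :
    ∫ x : ℝ, (hermitePoly m * hermitePoly n).eval x * Real.exp (-x ^ 2) = 0 := by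
  have key {i j : ℕ} (h : i < j) : (hermitePoly i).degree < j :=
    (Polynomial.degree_le_of_natDegree_le (natDegree_hermitePoly_le i)).trans_lt
      (by exact_mod_cast h)
  rcases hmn.lt_or_gt with h | h
  · rw [mul_comm]
    exact integral_hermitePoly_mul_eq_zero (key h)
  · exact integral_hermitePoly_mul_eq_zero (key h)

/-- The product `Hᵢ(u) Hⱼ(v) Hₖ(w)` of Hermite polynomials at elements of an algebra. -/
noncomputable def hermiteProd {A : Type*} [CommRing A] [Algebra ℝ A] (i j k : ℕ) (u v w : A) : A :=
  Polynomial.aeval u (hermitePoly i) * Polynomial.aeval v (hermitePoly j) *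
    Polynomial.aeval w (hermitePoly k)

theorem two_mul_aeval_hermitePoly_sub {A : Type*} [CommRing A] [Algebra ℝ A]
    (D : Derivation ℝ A A) {u g : A} (hu : D u = 1) (hg : D g = 0) (i : ℕ) :
    2 * u * (Polynomial.aeval u (hermitePoly i) * g) -
      D (Polynomial.aeval u (hermitePoly i) * g) =
        Polynomial.aeval u (hermitePoly (i + 1)) * g := by
  rw [D.leibniz, hg, Derivation.map_aeval, hu, hermitePoly]
  simp only [smul_eq_mul, map_sub, map_mul, Polynomial.aeval_X, map_ofNat]
  ring

/-- The span of the products of Hermite polynomials of total degree `N` in three variables. -/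
noncomputable def hermiteSpan (N : ℕ) : Submodule ℝ (MvPolynomial (Fin 3) ℝ) :=
  Submodule.span ℝ {P | ∃ i j k : ℕ, i + j + k = N ∧
    P = hermiteProd i j k (MvPolynomial.X 0) (MvPolynomial.X 1) (MvPolynomial.X 2)}

/-- The creation operator `2 Xₘ - ∂ₘ`. -/
noncomputable def raise (m : Fin 3) : MvPolynomial (Fin 3) ℝ →ₗ[ℝ] MvPolynomial (Fin 3) ℝ :=
  LinearMap.mulLeft ℝ (2 * MvPolynomial.X m) - (MvPolynomial.pderiv m).toLinearMap

theorem raise_apply (m : Fin 3) (P : MvPolynomial (Fin 3) ℝ) :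
    raise m P = 2 * MvPolynomial.X m * P - MvPolynomial.pderiv m P := rfl

theorem Derivation.map_aeval_eq_zero {A : Type*} [CommRing A] [Algebra ℝ A]
    (D : Derivation ℝ A A) {u : A} (hu : D u = 0) (p : Polynomial ℝ) :
    D (Polynomial.aeval u p) = 0 := by
  rw [Derivation.map_aeval, hu, smul_zero]

theorem Derivation.map_mul_eq_zero {A : Type*} [CommRing A] [Algebra ℝ A]
    (D : Derivation ℝ A A) {u v : A} (hu : D u = 0) (hv : D v = 0) : D (u * v) = 0 := by
  rw [D.leibniz, hu, hv, smul_zero, smul_zero, add_zero]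

section Products

variable {A : Type*} [CommRing A] [Algebra ℝ A] (D : Derivation ℝ A A) {u v w : A} (i j k : ℕ)

theorem hermiteProd_succ_left (hu : D u = 1) (hv : D v = 0) (hw : D w = 0) :
    2 * u * hermiteProd i j k u v w - D (hermiteProd i j k u v w) =
      hermiteProd (i + 1) j k u v w := by
  simp only [hermiteProd, mul_assoc (Polynomial.aeval u _)]
  exact two_mul_aeval_hermitePoly_sub D hu
    (D.map_mul_eq_zero (D.map_aeval_eq_zero hv _) (D.map_aeval_eq_zero hw _)) i

theorem hermiteProd_rotate : hermiteProd i j k u v w = hermiteProd j k i v w u := by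
  simp only [hermiteProd]; ring

theorem hermiteProd_succ_middle (hu : D u = 0) (hv : D v = 1) (hw : D w = 0) :
    2 * v * hermiteProd i j k u v w - D (hermiteProd i j k u v w) =
      hermiteProd i (j + 1) k u v w := by
  rw [hermiteProd_rotate i j k, hermiteProd_rotate i (j + 1) k]
  exact hermiteProd_succ_left D j k i hv hw hu

theorem hermiteProd_succ_right (hu : D u = 0) (hv : D v = 0) (hw : D w = 1) :
    2 * w * hermiteProd i j k u v w - D (hermiteProd i j k u v w) =
      hermiteProd i j (k + 1) u v w := by
  rw [← hermiteProd_rotate k i j, ← hermiteProd_rotate (k + 1) i j]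
  exact hermiteProd_succ_left D k i j hw hu hv

end Products

theorem raise_mem_hermiteSpan {N : ℕ} (m : Fin 3) {P : MvPolynomial (Fin 3) ℝ}
    (hP : P ∈ hermiteSpan N) : raise m P ∈ hermiteSpan (N + 1) := by
  revert P
  change hermiteSpan N ≤ (hermiteSpan (N + 1)).comap (raise m)
  refine Submodule.span_le.2 ?_
  rintro _ ⟨i, j, k, rfl, rfl⟩
  refine Submodule.subset_span ?_
  rw [raise_apply]
  fin_cases m
  · exact ⟨i + 1, j, k, by omega, hermiteProd_succ_left _ i j k (by simp) (by simp) (by simp)⟩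
  · exact ⟨i, j + 1, k, by omega, hermiteProd_succ_middle _ i j k (by simp) (by simp) (by simp)⟩
  · exact ⟨i, j, k + 1, by omega, hermiteProd_succ_right _ i j k (by simp) (by simp) (by simp)⟩

/-- The linear form with coefficients `a`. -/
noncomputable def linForm (a : Fin 3 → ℝ) : MvPolynomial (Fin 3) ℝ :=
  ∑ m, a m • MvPolynomial.X m

/-- The derivative in the direction `a`. -/
noncomputable def dirDeriv (a : Fin 3 → ℝ) :
    Derivation ℝ (MvPolynomial (Fin 3) ℝ) (MvPolynomial (Fin 3) ℝ) :=
  ∑ m, a m • MvPolynomial.pderiv m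

theorem dirDeriv_linForm (a b : Fin 3 → ℝ) : dirDeriv a (linForm b) = MvPolynomial.C (a ⬝ᵥ b) := by
  simp [dirDeriv, linForm, Fin.sum_univ_three, dotProduct, MvPolynomial.pderiv_X,
    MvPolynomial.smul_eq_C_mul]

theorem two_mul_linForm_mul_sub_mem {N : ℕ} (a : Fin 3 → ℝ) {P : MvPolynomial (Fin 3) ℝ}
    (hP : P ∈ hermiteSpan N) : 2 * linForm a * P - dirDeriv a P ∈ hermiteSpan (N + 1) := by
  have h : 2 * linForm a * P - dirDeriv a P = ∑ m, a m • raise m P := by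
    simp only [raise_apply, linForm, dirDeriv, Fin.sum_univ_three, MvPolynomial.smul_eq_C_mul,
      Derivation.add_apply, Derivation.smul_apply]
    ring
  rw [h]
  exact Submodule.sum_mem _ fun m _ => Submodule.smul_mem _ _ (raise_mem_hermiteSpan m hP)

theorem hermiteProd_linForm_mem {a b c : Fin 3 → ℝ} (haa : a ⬝ᵥ a = 1) (hbb : b ⬝ᵥ b = 1)
    (hcc : c ⬝ᵥ c = 1) (hab : a ⬝ᵥ b = 0) (hac : a ⬝ᵥ c = 0) (hbc : b ⬝ᵥ c = 0) (i j k : ℕ) :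
    hermiteProd i j k (linForm a) (linForm b) (linForm c) ∈ hermiteSpan (i + j + k) := by
  have hba := hab
  have hca := hac
  have hcb := hbc
  rw [dotProduct_comm] at hba hca hcb
  induction i with
  | succ i ih =>
    rw [← hermiteProd_succ_left (dirDeriv a) i j k (by simp [dirDeriv_linForm, *])
      (by simp [dirDeriv_linForm, *]) (by simp [dirDeriv_linForm, *]),
      show i + 1 + j + k = i + j + k + 1 by omega]
    exact two_mul_linForm_mul_sub_mem a ih
  | zero =>
    induction j with
    | succ j ih =>
      rw [← hermiteProd_succ_middle (dirDeriv b) 0 j k (by simp [dirDeriv_linForm, *])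
        (by simp [dirDeriv_linForm, *]) (by simp [dirDeriv_linForm, *]),
        show 0 + (j + 1) + k = 0 + j + k + 1 by omega]
      exact two_mul_linForm_mul_sub_mem b ih
    | zero =>
      induction k with
      | succ k ih =>
        rw [← hermiteProd_succ_right (dirDeriv c) 0 0 k (by simp [dirDeriv_linForm, *])
          (by simp [dirDeriv_linForm, *]) (by simp [dirDeriv_linForm, *])]
        exact two_mul_linForm_mul_sub_mem c ih
      | zero => exact Submodule.subset_span ⟨0, 0, 0, rfl, by simp [hermiteProd, hermitePoly]⟩

theorem eval_hermiteProd (f : Fin 3 → ℝ) (i j k : ℕ) (u v w : MvPolynomial (Fin 3) ℝ) :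
    MvPolynomial.eval f (hermiteProd i j k u v w) =
      (hermitePoly i).eval (MvPolynomial.eval f u) * (hermitePoly j).eval (MvPolynomial.eval f v) *
        (hermitePoly k).eval (MvPolynomial.eval f w) := by
  have h (p : Polynomial ℝ) (u : MvPolynomial (Fin 3) ℝ) :
      MvPolynomial.eval f (Polynomial.aeval u p) = p.eval (MvPolynomial.eval f u) := by
    have := Polynomial.aeval_algHom_apply (MvPolynomial.aeval (R := ℝ) f) u p
    simpa [MvPolynomial.coe_aeval_eq_eval] using this.symm
  simp only [hermiteProd, map_mul, h]

theorem exists_integral_eval_mul_hermitePoly {n : ℕ} {P : MvPolynomial (Fin 3) ℝ}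
    (hP : P ∈ hermiteSpan (3 * n)) :
    ∃ ω : ℝ, ∀ x : ℝ, Integrable (fun q : ℝ × ℝ => MvPolynomial.eval ![q.1, q.2, x] P *
        ((hermitePoly n).eval q.1 * Real.exp (-q.1 ^ 2) *
          ((hermitePoly n).eval q.2 * Real.exp (-q.2 ^ 2)))) ∧
      ∫ q : ℝ × ℝ, MvPolynomial.eval ![q.1, q.2, x] P *
        ((hermitePoly n).eval q.1 * Real.exp (-q.1 ^ 2) *
          ((hermitePoly n).eval q.2 * Real.exp (-q.2 ^ 2))) = ω * (hermitePoly n).eval x := by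
  induction hP using Submodule.span_induction with
  | zero => exact ⟨0, fun x => by simp⟩
  | add P Q _ _ hP hQ =>
    obtain ⟨a, ha⟩ := hP
    obtain ⟨b, hb⟩ := hQ
    refine ⟨a + b, fun x => ?_⟩
    simp only [map_add, add_mul]
    exact ⟨(ha x).1.add (hb x).1, by rw [integral_add (ha x).1 (hb x).1, (ha x).2, (hb x).2]⟩
  | smul c P _ hP =>
    obtain ⟨a, ha⟩ := hP
    refine ⟨c * a, fun x => ?_⟩
    simp only [MvPolynomial.smul_eval, mul_assoc c]
    exact ⟨(ha x).1.const_mul c, by rw [integral_const_mul, (ha x).2]⟩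
  | mem P hP =>
    obtain ⟨i, j, k, hijk, rfl⟩ := hP
    let I (m : ℕ) := ∫ x : ℝ, (hermitePoly m * hermitePoly n).eval x * Real.exp (-x ^ 2)
    have hI {m : ℕ} (h : m ≠ n) : I m = 0 := integral_hermitePoly_mul_hermitePoly h
    have key (x : ℝ) : (fun q : ℝ × ℝ => MvPolynomial.eval ![q.1, q.2, x]
        (hermiteProd i j k (MvPolynomial.X 0) (MvPolynomial.X 1) (MvPolynomial.X 2)) *
        ((hermitePoly n).eval q.1 * Real.exp (-q.1 ^ 2) *
          ((hermitePoly n).eval q.2 * Real.exp (-q.2 ^ 2)))) =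
        fun q : ℝ × ℝ => ((hermitePoly i * hermitePoly n).eval q.1 * Real.exp (-q.1 ^ 2) *
          ((hermitePoly j * hermitePoly n).eval q.2 * Real.exp (-q.2 ^ 2))) *
            (hermitePoly k).eval x := by
      ext q
      simp only [eval_hermiteProd, MvPolynomial.eval_X, Polynomial.eval_mul, Matrix.cons_val]
      ring
    refine ⟨I i * I j, fun x => ?_⟩
    rw [key]
    refine ⟨((integrable_eval_mul_exp_neg_sq _).mul_prod
      (integrable_eval_mul_exp_neg_sq _)).mul_const _, ?_⟩
    rw [integral_mul_const, Measure.volume_eq_prod,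
      integral_prod_mul (fun y => (hermitePoly i * hermitePoly n).eval y * Real.exp (-y ^ 2))
        (fun z => (hermitePoly j * hermitePoly n).eval z * Real.exp (-z ^ 2))]
    change I i * I j * _ = _
    by_cases hi : i = n
    · by_cases hj : j = n
      · rw [show k = n by omega]
      · simp [hI hj]
    · simp [hI hi]

/-- The Hermite function `φₙ`, as a real-valued function. -/
noncomputable def hermiteFunReal (n : ℕ) (x : ℝ) : ℝ :=
  (hermitePoly n).eval x * Real.exp (-x ^ 2 / 2)

theorem hermiteFun_eq_ofReal (n : ℕ) (x : ℝ) : hermiteFun n x = (hermiteFunReal n x : ℂ) := by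
  rw [hermiteFun, physHermite_eq_eval, hermiteFunReal]

@[fun_prop]
theorem continuous_hermiteFunReal (n : ℕ) : Continuous (hermiteFunReal n) := by
  unfold hermiteFunReal
  fun_prop

theorem hermiteFunReal_eq (n : ℕ) :
    hermiteFunReal n = fun x => (hermitePoly n).eval x * Real.exp (-(1 / 2) * x ^ 2) := by
  ext x
  rw [hermiteFunReal]
  ring_nf

theorem integrable_hermiteFunReal (n : ℕ) : Integrable (hermiteFunReal n) := by
  rw [hermiteFunReal_eq]
  exact integrable_eval_mul_exp_neg_mul_sq _ (by norm_num)

theorem exists_abs_hermiteFunReal_le (n : ℕ) : ∃ C, ∀ x, |hermiteFunReal n x| ≤ C := by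
  rw [hermiteFunReal_eq]
  exact exists_abs_eval_mul_exp_neg_mul_sq_le _ (by norm_num)

theorem one_sub_add_sq_pos (l : ℝ) : 0 < 1 - l + l ^ 2 := by
  nlinarith [sq_nonneg (2 * l - 1)]

theorem integrable_inv_one_sub_add_sq : Integrable fun l : ℝ => (1 - l + l ^ 2)⁻¹ := by
  have h := (integrable_inv_one_add_sq.comp_sub_right (1 / 2)).const_mul (4 / 3)
  refine h.mono' (by fun_prop) (.of_forall fun l => ?_)
  have hl := one_sub_add_sq_pos l
  rw [Real.norm_of_nonneg (by positivity), ← div_eq_mul_inv, inv_eq_one_div,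
    div_le_div_iff₀ hl (by positivity)]
  nlinarith [sq_nonneg (2 * l - 1)]

/-- The linear map `(β, ξ) ↦ (lβ + ξ, β + (1 - l)ξ)`. -/
noncomputable def shearMap (l : ℝ) : ℝ × ℝ →ₗ[ℝ] ℝ × ℝ :=
  Matrix.toLin (Module.Basis.finTwoProd ℝ) (Module.Basis.finTwoProd ℝ) !![l, 1; 1, 1 - l]

theorem shearMap_apply (l : ℝ) (q : ℝ × ℝ) :
    shearMap l q = (l * q.1 + q.2, q.1 + (1 - l) * q.2) := by
  rw [shearMap, Matrix.toLin_finTwoProd_apply, one_mul, one_mul]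

theorem det_shearMap (l : ℝ) : LinearMap.det (shearMap l) = -(1 - l + l ^ 2) := by
  rw [shearMap, LinearMap.det_toLin, Matrix.det_fin_two_of]
  ring

theorem map_shearMap_volume (l : ℝ) :
    (volume : Measure (ℝ × ℝ)).map (shearMap l) =
      ENNReal.ofReal (1 - l + l ^ 2)⁻¹ • (volume : Measure (ℝ × ℝ)) := by
  have hl := one_sub_add_sq_pos l
  rw [Measure.map_linearMap_addHaar_eq_smul_addHaar _ (by rw [det_shearMap]; linarith),
    det_shearMap, inv_neg, abs_neg, abs_of_pos (by positivity)]

theorem measurable_shearMap (l : ℝ) : Measurable (shearMap l) :=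
  (shearMap l).continuous_of_finiteDimensional.measurable

theorem integrable_comp_shearMap_add {F : ℝ × ℝ → ℝ} (hF : Integrable F)
    (l : ℝ) (v : ℝ × ℝ) : Integrable fun q => F (shearMap l q + v) := by
  have h : Integrable (fun q => F (q + v)) ((volume : Measure (ℝ × ℝ)).map (shearMap l)) := by
    rw [map_shearMap_volume]
    exact (hF.comp_add_right v).smul_measure ENNReal.ofReal_ne_top
  exact (integrable_map_measure h.1 (measurable_shearMap l).aemeasurable).1 h

theorem integral_comp_shearMap_add {F : ℝ × ℝ → ℝ} (hF : Continuous F) (l : ℝ) (v : ℝ × ℝ) :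
    ∫ q, F (shearMap l q + v) = (1 - l + l ^ 2)⁻¹ * ∫ q, F q := by
  have hl := one_sub_add_sq_pos l
  have hc : Continuous fun q => F (q + v) := by fun_prop
  rw [← integral_map (f := fun q => F (q + v)) (measurable_shearMap l).aemeasurable
    hc.aestronglyMeasurable, map_shearMap_volume, integral_smul_measure,
    integral_add_right_eq_self, ENNReal.toReal_ofReal (by positivity), smul_eq_mul]

/-- The integrand of `𝓣₆(φₙ, φₙ, φₙ, φₙ, φₙ)(x)` in the variables `((β, ξ), λ)`. -/
noncomputable def hermiteIntegrand (n : ℕ) (x : ℝ) (p : (ℝ × ℝ) × ℝ) : ℝ :=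
  hermiteFunReal n (p.1.1 + p.1.2) * hermiteFunReal n (p.2 * p.1.1 + x) *
    hermiteFunReal n (p.2 * x + p.1.2 - p.2 * p.1.2) *
    (hermiteFunReal n (p.2 * p.1.1 + p.1.2) *
      hermiteFunReal n (p.1.1 + p.2 * x + p.1.2 - p.2 * p.1.2))

@[fun_prop]
theorem continuous_hermiteIntegrand (n : ℕ) (x : ℝ) : Continuous (hermiteIntegrand n x) := by
  unfold hermiteIntegrand
  fun_prop

theorem T6_hermiteFun (n : ℕ) (x : ℝ) :
    T6 (hermiteFun n) (hermiteFun n) (hermiteFun n) (hermiteFun n) (hermiteFun n) x =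
      ((3 / π ^ 2 * ∫ p, hermiteIntegrand n x p : ℝ) : ℂ) := by
  have h := (volume_preserving_prodAssoc (α₁ := ℝ) (β₁ := ℝ) (γ₁ := ℝ)).integral_comp'
    (fun p : ℝ × ℝ × ℝ => hermiteIntegrand n x ((p.1, p.2.1), p.2.2))
  rw [show (∫ p, hermiteIntegrand n x p) = _ from h, Complex.ofReal_mul,
    ← integral_complex_ofReal, T6]
  congr 2
  ext p
  simp [hermiteFun_eq_ofReal, hermiteIntegrand]

theorem integrable_hermiteFunReal_mul (n : ℕ) :
    Integrable fun q : ℝ × ℝ => hermiteFunReal n q.1 * hermiteFunReal n q.2 :=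
  (integrable_hermiteFunReal n).mul_prod (integrable_hermiteFunReal n)

theorem norm_hermiteIntegrand_le {n : ℕ} {C : ℝ} (hC : ∀ x, |hermiteFunReal n x| ≤ C)
    (x l : ℝ) (q : ℝ × ℝ) :
    ‖hermiteIntegrand n x (q, l)‖ ≤
      C ^ 3 * ‖hermiteFunReal n (shearMap l q + (0, l * x)).1 *
        hermiteFunReal n (shearMap l q + (0, l * x)).2‖ := by
  have hC0 : 0 ≤ C := (abs_nonneg _).trans (hC 0)
  have h1 : (shearMap l q + (0, l * x)).1 = l * q.1 + q.2 := by simp [shearMap_apply]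
  have h2 : (shearMap l q + (0, l * x)).2 = q.1 + l * x + q.2 - l * q.2 := by
    simp only [shearMap_apply, Prod.snd_add]; ring
  rw [h1, h2, hermiteIntegrand, norm_mul, norm_mul, norm_mul, pow_succ, pow_two]
  simp only [Real.norm_eq_abs]
  gcongr <;> apply hC

theorem integrable_hermiteIntegrand (n : ℕ) (x : ℝ) : Integrable (hermiteIntegrand n x) := by
  obtain ⟨C, hC⟩ := exists_abs_hermiteFunReal_le n
  let G (q : ℝ × ℝ) : ℝ := C ^ 3 * ‖hermiteFunReal n q.1 * hermiteFunReal n q.2‖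
  have hG : Continuous G := by fun_prop
  have hGi : Integrable G := (integrable_hermiteFunReal_mul n).norm.const_mul _
  have hle := norm_hermiteIntegrand_le hC x
  have hsec (l : ℝ) := integrable_comp_shearMap_add hGi l (0, l * x)
  have hint (l : ℝ) : Integrable fun q => hermiteIntegrand n x (q, l) :=
    (hsec l).mono' (Continuous.aestronglyMeasurable (by fun_prop)) (.of_forall (hle l))
  have hm : AEStronglyMeasurable (hermiteIntegrand n x)
      ((volume : Measure (ℝ × ℝ)).prod (volume : Measure ℝ)) :=
    (continuous_hermiteIntegrand n x).aestronglyMeasurable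
  rw [Measure.volume_eq_prod, integrable_prod_iff' hm]
  refine ⟨.of_forall hint, ?_⟩
  refine (integrable_inv_one_sub_add_sq.mul_const (∫ q, G q)).mono'
    hm.norm.prod_swap.integral_prod_right' (.of_forall fun l => ?_)
  rw [← integral_comp_shearMap_add hG l (0, l * x), Real.norm_of_nonneg (by positivity)]
  exact integral_mono (hint l).norm (hsec l) (hle l)

/-- The rows of a rotation about the axis `(1, 1, 1)`, whose angle depends on `l`. -/
noncomputable def circRow (l : ℝ) (k : Fin 3) : Fin 3 → ℝ :=
  (1 - l + l ^ 2)⁻¹ • ![![l, 1 - l, l ^ 2 - l], ![l ^ 2 - l, l, 1 - l], ![1 - l, l ^ 2 - l, l]] k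

theorem circRow_dotProduct (l : ℝ) (j k : Fin 3) :
    circRow l j ⬝ᵥ circRow l k = if j = k then 1 else 0 := by
  have hl := (one_sub_add_sq_pos l).ne'
  fin_cases j <;> fin_cases k <;>
    simp [circRow, dotProduct, Fin.sum_univ_three] <;> field_simp <;> ring

theorem exists_integral_hermiteIntegrand_eq (n : ℕ) (l : ℝ) :
    ∃ ω : ℝ, ∀ x, ∫ q, hermiteIntegrand n x (q, l) = ω * hermiteFunReal n x := by
  have hl := (one_sub_add_sq_pos l).ne'
  have hmem := hermiteProd_linForm_mem (a := circRow l 0) (b := circRow l 1) (c := circRow l 2)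
    (by simp [circRow_dotProduct]) (by simp [circRow_dotProduct]) (by simp [circRow_dotProduct])
    (by simp [circRow_dotProduct]) (by simp [circRow_dotProduct]) (by simp [circRow_dotProduct])
    n n n
  rw [show n + n + n = 3 * n by ring] at hmem
  obtain ⟨ω, hω⟩ := exists_integral_eval_mul_hermitePoly hmem
  refine ⟨(1 - l + l ^ 2)⁻¹ * ω, fun x => ?_⟩
  let F (q : ℝ × ℝ) : ℝ := MvPolynomial.eval ![q.1, q.2, x]
      (hermiteProd n n n (linForm (circRow l 0)) (linForm (circRow l 1)) (linForm (circRow l 2))) *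
    ((hermitePoly n).eval q.1 * Real.exp (-q.1 ^ 2) *
      ((hermitePoly n).eval q.2 * Real.exp (-q.2 ^ 2))) * Real.exp (-x ^ 2 / 2)
  have hF : Continuous F := by
    simp only [F, eval_hermiteProd, linForm, Fin.sum_univ_three, map_add, MvPolynomial.smul_eval,
      MvPolynomial.eval_X, Matrix.cons_val]
    fun_prop
  have key (q : ℝ × ℝ) : hermiteIntegrand n x (q, l) = F (shearMap l q + (0, l * x)) := by
    obtain ⟨b, c⟩ := q
    have e0 : MvPolynomial.eval ![l * b + c, b + (1 - l) * c + l * x, x]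
        (linForm (circRow l 0)) = b + c := by
      simp [linForm, Fin.sum_univ_three, circRow]
      field_simp
      ring
    have e1 : MvPolynomial.eval ![l * b + c, b + (1 - l) * c + l * x, x]
        (linForm (circRow l 1)) = l * b + x := by
      simp [linForm, Fin.sum_univ_three, circRow]
      field_simp
      ring
    have e2 : MvPolynomial.eval ![l * b + c, b + (1 - l) * c + l * x, x]
        (linForm (circRow l 2)) = l * x + c - l * c := by
      simp [linForm, Fin.sum_univ_three, circRow]
      field_simp
      ring
    have e3 : b + l * x + c - l * c = b + (1 - l) * c + l * x := by ring
    have hexp : Real.exp (-(b + c) ^ 2 / 2) * Real.exp (-(l * b + x) ^ 2 / 2) *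
        Real.exp (-(l * x + c - l * c) ^ 2 / 2) * (Real.exp (-(l * b + c) ^ 2 / 2) *
          Real.exp (-(b + (1 - l) * c + l * x) ^ 2 / 2)) =
        Real.exp (-(l * b + c) ^ 2) * Real.exp (-(b + (1 - l) * c + l * x) ^ 2) *
          Real.exp (-x ^ 2 / 2) := by
      simp only [← Real.exp_add]
      ring_nf
    simp only [F, shearMap_apply, Prod.mk_add_mk, add_zero, eval_hermiteProd, e0, e1, e2]
    simp only [hermiteIntegrand, hermiteFunReal, e3]
    linear_combination (hermitePoly n).eval (b + c) * (hermitePoly n).eval (l * b + x) *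
      (hermitePoly n).eval (l * x + c - l * c) * (hermitePoly n).eval (l * b + c) *
      (hermitePoly n).eval (b + (1 - l) * c + l * x) * hexp
  simp only [key]
  rw [integral_comp_shearMap_add hF, integral_mul_const, (hω x).2, hermiteFunReal]
  ring

theorem stmt19 (n : ℕ) :
    ∃ ω : ℝ, ∀ x : ℝ,
      T6 (hermiteFun n) (hermiteFun n) (hermiteFun n) (hermiteFun n) (hermiteFun n) x
        = (ω : ℂ) * hermiteFun n x := by
  choose ω hω using exists_integral_hermiteIntegrand_eq n
  refine ⟨3 / π ^ 2 * ∫ l, ω l, fun x => ?_⟩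
  have h := integral_prod_symm (hermiteIntegrand n x) (integrable_hermiteIntegrand n x)
  simp only [hω, integral_mul_const] at h
  rw [T6_hermiteFun, Measure.volume_eq_prod, h, hermiteFun_eq_ofReal, ← Complex.ofReal_mul,
    mul_assoc]
end
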